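/- Assume μ satisfies (aa) and let g be the function from the previous statement (formula (calka)). Then for each v₀, λ ∈ ℂ and each T > 0 there exists a unique absolutely continuous function v on [0,T] with v(0) = v₀ and (k * v′)(t) + λ v(t) = 0 for a.e. t ∈ (0,T); moreover v is given by v(t) = v₀ · Σ_{k=0}^∞ (−λ)^k (g^{[k]} * 1)(t), where g^{[k]} denotes the k-fold convolution g * ⋯ * g (with g^{[0]} * 1 := 1), and the series converges absolutely in the Sobolev space W^{1,1}(0,T) for each T > 0. -/

import Mathlib

open MeasureTheory Set Real

/-- The kernel `k(t) = ∫₀¹ t^{-α} μ(α)/Γ(1-α) dα`. -/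
noncomputable def kker (μ : ℝ → ℝ) (t : ℝ) : ℝ :=
  ∫ α in Ioo (0:ℝ) 1, t ^ (-α) * μ α / Real.Gamma (1 - α)

/-- The kernel `g` given by formula (calka). -/
noncomputable def gker (μ : ℝ → ℝ) (t : ℝ) : ℝ :=
  (1 / π) * ∫ r in Ioi (0:ℝ),
    Real.exp (-r * t) *
      ((∫ α in Ioo (0:ℝ) 1, Real.sin (π * α) * r ^ α * μ α) /
        ((∫ α in Ioo (0:ℝ) 1, Real.cos (π * α) * r ^ α * μ α) ^ 2 +
          (∫ α in Ioo (0:ℝ) 1, Real.sin (π * α) * r ^ α * μ α) ^ 2))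

/-- The iterated convolution `g^{[n]} * 1`, with `g^{[0]} * 1 = 1`. -/
noncomputable def conv1 (g : ℝ → ℝ) : ℕ → ℝ → ℝ
  | 0 => fun _ => 1
  | n + 1 => fun t => ∫ s in (0:ℝ)..t, g (t - s) * conv1 g n s

/-- The derivative of `g^{[n]} * 1`, i.e. the `n`-fold convolution `g^{[n]}`
(with the convention that the derivative of the constant `1` is `0`). -/
noncomputable def convD (g : ℝ → ℝ) : ℕ → ℝ → ℝ
  | 0 => fun _ => 0
  | 1 => g
  | n + 2 => fun t => ∫ s in (0:ℝ)..t, g (t - s) * convD g (n + 1) s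

open Filter Topology in
lemma tendsto_exp_mul_div_sub_atTop {β : ℝ} (h0 : 0 < β) (s : ℝ) :
    Tendsto (fun x : ℝ => exp (-β * x) * (exp x / |exp x - s|)) atTop (𝓝 0) := by
  have h1 : Tendsto (fun x : ℝ => exp (-β * x)) atTop (𝓝 0) :=
    Real.tendsto_exp_atBot.comp (tendsto_id.const_mul_atTop_of_neg (by linarith))
  have h2 : Tendsto (fun x : ℝ => |1 - s * exp (-x)|⁻¹) atTop (𝓝 1) := by
    have : Tendsto (fun x : ℝ => |1 - s * exp (-x)|⁻¹) atTop (𝓝 (|1 - s * 0|⁻¹)) := by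
      refine Tendsto.inv₀ ?_ (by simp)
      exact (tendsto_const_nhds.sub
        ((Real.tendsto_exp_atBot.comp tendsto_neg_atTop_atBot).const_mul s)).abs
    simpa using this
  have h3 := h1.mul h2
  rw [zero_mul] at h3
  refine h3.congr fun x => ?_
  have : exp x - s = exp x * (1 - s * exp (-x)) := by
    rw [Real.exp_neg]; field_simp
  rw [this, abs_mul, abs_of_pos (exp_pos x)]
  congr 1
  have := (exp_pos x).ne'
  rw [div_eq_mul_inv, mul_inv, ← mul_assoc, mul_inv_cancel₀ this, one_mul]

open Filter Topology in
lemma tendsto_exp_mul_div_sub_atBot {β : ℝ} (h1 : β < 1) {s : ℝ} (hs : 0 < s) :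
    Tendsto (fun x : ℝ => exp (-β * x) * (exp x / |exp x - s|)) atBot (𝓝 0) := by
  have h3 : Tendsto (fun x : ℝ => exp ((1 - β) * x) * |exp x - s|⁻¹) atBot
      (𝓝 (0 * |0 - s|⁻¹)) := by
    refine Tendsto.mul ?_ (Tendsto.inv₀ (Real.tendsto_exp_atBot.sub_const s).abs (by simp [hs.ne']))
    exact Real.tendsto_exp_atBot.comp (tendsto_id.const_mul_atBot (by linarith))
  rw [zero_mul] at h3
  refine h3.congr fun x => ?_
  rw [div_eq_mul_inv, ← mul_assoc, ← Real.exp_add]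
  ring_nf

lemma integrable_exp_mul_div_add {β : ℝ} (h0 : 0 < β) (h1 : β < 1) {s : ℝ} (hs : 0 < s) :
    Integrable (fun x : ℝ => exp (-β * x) * (exp x / (exp x + s))) := by
  have hc : Continuous (fun x : ℝ => exp (-β * x) * (exp x / (exp x + s))) := by
    have : ∀ x, exp x + s ≠ 0 := fun x => by positivity
    fun_prop (disch := assumption)
  rw [← integrableOn_univ, ← Iic_union_Ioi (a := 0)]
  refine IntegrableOn.union ?_ ?_
  · refine Integrable.mono' (g := fun x => exp ((1 - β) * x) * s⁻¹)
      ((integrableOn_exp_mul_Iic (by linarith) 0).mul_const _) hc.aestronglyMeasurable ?_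
    refine ae_of_all _ fun x => ?_
    rw [Real.norm_of_nonneg (by positivity), div_eq_mul_inv, ← mul_assoc, ← Real.exp_add]
    have : (exp x + s)⁻¹ ≤ s⁻¹ := by
      gcongr; linarith [exp_pos x]
    calc _ ≤ exp (-β * x + x) * s⁻¹ := by gcongr
      _ = _ := by ring_nf
  · refine Integrable.mono' (g := fun x => exp (-β * x))
      (integrableOn_exp_mul_Ioi (by linarith) 0) hc.aestronglyMeasurable ?_
    refine ae_of_all _ fun x => ?_
    rw [Real.norm_of_nonneg (by positivity)]
    refine mul_le_of_le_one_right (exp_pos _).le ?_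
    rw [div_le_one (by positivity)]
    linarith

/-- The exponential is injective near the real axis: `exp w = exp a` with `a` real and
`|Im w| ≤ π` forces `w = a`. -/
lemma eq_of_cexp_eq_of_abs_im_le {w : ℂ} {a : ℝ} (hw : |w.im| ≤ π)
    (h : Complex.exp w = Complex.exp a) : w = a := by
  obtain ⟨n, hn⟩ := Complex.exp_eq_exp_iff_exists_int.1 h
  have him : w.im = n * (2 * π) := by rw [hn]; simp
  have hn0 : n = 0 := by
    by_contra hne
    have h1 : (1 : ℝ) ≤ |(n : ℝ)| := by exact_mod_cast Int.one_le_abs hne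
    rw [him, abs_mul, abs_of_pos (by positivity : (0:ℝ) < 2 * π)] at hw
    nlinarith [Real.pi_pos]
  simpa [hn0] using hn

lemma integral_exp_half_div_add (a : ℝ) :
    ∫ x : ℝ, exp (-(x / 2)) * (exp x / (exp x + exp a)) = π * exp (-(a / 2)) := by
  have hint := integrable_exp_mul_div_add (β := 1 / 2) (by norm_num) (by norm_num) (exp_pos a)
  have hint' : Integrable (fun x : ℝ => exp (-(x / 2)) * (exp x / (exp x + exp a))) := by
    refine hint.congr (ae_of_all _ fun x => ?_)
    simp only
    congr 2; ring
  have hd : ∀ x : ℝ, HasDerivAt (fun x => 2 * exp (-(a / 2)) * arctan (exp ((x - a) / 2)))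
      (exp (-(x / 2)) * (exp x / (exp x + exp a))) x := by
    intro x
    have h1 : HasDerivAt (fun x : ℝ => (x - a) / 2) (1 / 2) x :=
      ((hasDerivAt_id x).sub_const a).div_const 2
    convert! (h1.exp.arctan.const_mul (2 * exp (-(a / 2)))) using 1
    obtain ⟨p, rfl⟩ : ∃ p, x = 2 * p := ⟨x / 2, by ring⟩
    obtain ⟨q, rfl⟩ : ∃ q, a = 2 * q := ⟨a / 2, by ring⟩
    have e1 : exp (-(2 * p / 2)) = (exp p)⁻¹ := by rw [← Real.exp_neg]; ring_nf
    have e2 : exp (-(2 * q / 2)) = (exp q)⁻¹ := by rw [← Real.exp_neg]; ring_nf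
    have e3 : exp (2 * p) = exp p ^ 2 := by rw [← Real.exp_nat_mul]; norm_num
    have e4 : exp (2 * q) = exp q ^ 2 := by rw [← Real.exp_nat_mul]; norm_num
    have e5 : exp ((2 * p - 2 * q) / 2) = exp p / exp q := by rw [← Real.exp_sub]; ring_nf
    rw [e1, e2, e3, e4, e5]
    have := exp_pos p
    have := exp_pos q
    field_simp
    ring
  rw [integral_of_hasDerivAt_of_tendsto (m := 0) (n := 2 * exp (-(a / 2)) * (π / 2)) hd hint']
  · ring
  · have h : Filter.Tendsto (fun x => 2 * exp (-(a / 2)) * arctan (exp ((x - a) / 2)))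
        Filter.atBot (nhds (2 * exp (-(a / 2)) * arctan 0)) := by
      refine Filter.Tendsto.const_mul _ ((continuous_arctan.tendsto 0).comp ?_)
      refine Real.tendsto_exp_atBot.comp ?_
      exact (Filter.tendsto_atBot_add_const_right _ (-a) Filter.tendsto_id).atBot_div_const
        (by norm_num)
    simpa using h
  · refine Filter.Tendsto.const_mul _ ?_
    refine (tendsto_nhds_of_tendsto_nhdsWithin tendsto_arctan_atTop).comp ?_
    refine Real.tendsto_exp_atTop.comp ?_
    exact (Filter.tendsto_atTop_add_const_right _ (-a) Filter.tendsto_id).atTop_div_const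
      (by norm_num)

lemma integrable_strip {N : ℂ → ℂ} {C δ : ℝ} (hδ0 : 0 < δ) (hδ1 : δ < 1)
    (hd : ∀ w : ℂ, |w.im| ≤ π → DifferentiableAt ℂ N w)
    (hb : ∀ w : ℂ, |w.im| ≤ π →
      ‖N w‖ ≤ C * (exp (-δ * w.re) + exp (-(1 - δ) * w.re)))
    (a : ℝ) {σ : ℝ} (hσ : |σ| ≤ π) :
    Integrable (fun x : ℝ =>
      N (x + σ * Complex.I) * ((exp x / (exp x + exp a) : ℝ) : ℂ)) := by
  have hg := ((integrable_exp_mul_div_add hδ0 hδ1 (exp_pos a)).add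
    (integrable_exp_mul_div_add (by linarith : 0 < 1 - δ) (by linarith) (exp_pos a))).const_mul C
  refine hg.mono' (Continuous.aestronglyMeasurable ?_) (ae_of_all _ fun x => ?_)
  · refine Continuous.mul ?_ (Complex.continuous_ofReal.comp ?_)
    · rw [continuous_iff_continuousAt]
      intro x
      exact ContinuousAt.comp (f := fun x : ℝ => (x + σ * Complex.I : ℂ))
        (hd _ (by simpa using hσ)).continuousAt (by fun_prop)
    · have : ∀ x, exp x + exp a ≠ 0 := fun x => by positivity
      fun_prop (disch := assumption)
  · have h1 := hb (x + σ * Complex.I) (by simpa using hσ)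
    have hre : (x + σ * Complex.I : ℂ).re = x := by simp
    rw [hre] at h1
    rw [norm_mul, Complex.norm_real, Real.norm_of_nonneg (by positivity)]
    simp only [Pi.add_apply]
    calc _ ≤ C * (exp (-δ * x) + exp (-(1 - δ) * x)) * (exp x / (exp x + exp a)) := by gcongr
      _ = _ := by ring

/-- Rectangular contour integral over `|Im w| ≤ π` for a function vanishing at the pole. -/
lemma integral_strip_eq_zero {N : ℂ → ℂ} {C δ a : ℝ} (hδ0 : 0 < δ) (hδ1 : δ < 1)
    (hd : ∀ w : ℂ, |w.im| ≤ π → DifferentiableAt ℂ N w)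
    (hb : ∀ w : ℂ, |w.im| ≤ π →
      ‖N w‖ ≤ C * (exp (-δ * w.re) + exp (-(1 - δ) * w.re)))
    (ha : N a = 0) :
    ∫ x : ℝ, (N (x - π * Complex.I) - N (x + π * Complex.I)) *
      ((exp x / (exp x + exp a) : ℝ) : ℂ) = 0 := by
  set S : Set ℂ := {w | |w.im| ≤ π} with hS
  have hSa : S ∈ nhds (a : ℂ) := by
    have : {w : ℂ | |w.im| < π} ∈ nhds (a : ℂ) :=
      (isOpen_lt (by fun_prop) continuous_const).mem_nhds (by simp [Real.pi_pos])
    exact Filter.mem_of_superset this fun w hw =>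
      show |w.im| ≤ π from le_of_lt (show |w.im| < π from hw)
  set h : ℂ → ℂ := fun w => dslope N a w * Complex.exp w / dslope Complex.exp a w with hh
  have hE : ∀ w ∈ S, dslope Complex.exp a w ≠ 0 := by
    intro w hw
    rcases eq_or_ne w a with rfl | hne
    · simp [dslope_same]
    · rw [dslope_of_ne _ hne, slope_def_field]
      refine div_ne_zero (sub_ne_zero.2 fun he => hne ?_) (sub_ne_zero.2 hne)
      exact eq_of_cexp_eq_of_abs_im_le hw he
  have hdiff : DifferentiableOn ℂ h S := by
    refine DifferentiableOn.div (DifferentiableOn.mul ?_ ?_) ?_ hE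
    · exact (Complex.differentiableOn_dslope hSa).2
        fun w hw => (hd w hw).differentiableWithinAt
    · fun_prop
    · exact (Complex.differentiableOn_dslope hSa).2 (by fun_prop)
  have hval : ∀ w : ℂ, w ≠ a → h w = N w * (Complex.exp w / (Complex.exp w - Complex.exp a)) := by
    intro w hne
    have : w - a ≠ 0 := sub_ne_zero.2 hne
    simp only [hh]
    rw [dslope_of_ne _ hne, dslope_of_ne _ hne, slope_def_field, slope_def_field, ha, sub_zero,
      div_mul_eq_mul_div, div_div_div_cancel_right₀ this, mul_div_assoc]
  have hpi : (π : ℂ) ≠ 0 := by exact_mod_cast Real.pi_ne_zero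
  have htop : ∀ x : ℝ, h (x + π * Complex.I) =
      N (x + π * Complex.I) * ((exp x / (exp x + exp a) : ℝ) : ℂ) := by
    intro x
    rw [hval _ (fun he => by simpa [Real.pi_ne_zero] using congrArg Complex.im he),
      Complex.exp_add, Complex.exp_pi_mul_I]
    congr 1
    push_cast
    rw [← neg_div_neg_eq]
    congr 1 <;> ring
  have hbot : ∀ x : ℝ, h (x - π * Complex.I) =
      N (x - π * Complex.I) * ((exp x / (exp x + exp a) : ℝ) : ℂ) := by
    intro x
    rw [hval _ (fun he => by simpa [Real.pi_ne_zero] using congrArg Complex.im he),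
      Complex.exp_sub, Complex.exp_pi_mul_I]
    congr 1
    push_cast
    rw [← neg_div_neg_eq]
    congr 1 <;> ring
  set bnd : ℝ → ℝ := fun x =>
    C * (exp (-δ * x) * (exp x / |exp x - exp a|) +
      exp (-(1 - δ) * x) * (exp x / |exp x - exp a|)) with hbnd
  have hside : ∀ x : ℝ, x ≠ a → ‖∫ y in (-π)..π, h (x + y * Complex.I)‖ ≤ bnd x * (2 * π) := by
    intro x hx
    have := intervalIntegral.norm_integral_le_of_norm_le_const (a := -π) (b := π)
      (f := fun y : ℝ => h (x + y * Complex.I)) (C := bnd x) ?_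
    · rwa [abs_of_pos (by linarith [Real.pi_pos]), sub_neg_eq_add, ← two_mul] at this
    · intro y hy
      rw [uIoc_of_le (by linarith [Real.pi_pos])] at hy
      have hy' : |y| ≤ π := abs_le.2 ⟨hy.1.le, hy.2⟩
      have h1 := hb (x + y * Complex.I) (by simpa using hy')
      rw [hval _ (fun he => hx (by simpa using congrArg Complex.re he)), norm_mul, norm_div]
      have hre : (x + y * Complex.I : ℂ).re = x := by simp
      rw [hre] at h1
      have h2 : ‖Complex.exp (x + y * Complex.I)‖ = exp x := by
        rw [Complex.norm_exp, hre]
      have h3 : |exp x - exp a| ≤ ‖Complex.exp (x + y * Complex.I) - Complex.exp a‖ := by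
        have := abs_norm_sub_norm_le (Complex.exp (x + y * Complex.I)) (Complex.exp a)
        rwa [h2, Complex.norm_exp, Complex.ofReal_re] at this
      have h4 : 0 < |exp x - exp a| := abs_pos.2 (sub_ne_zero.2 fun he => hx (exp_injective he))
      rw [h2]
      calc _ ≤ C * (exp (-δ * x) + exp (-(1 - δ) * x)) * (exp x / |exp x - exp a|) := by
            gcongr
            exact (norm_nonneg _).trans h1
        _ = bnd x := by simp only [hbnd]; ring
  have hbT : Filter.Tendsto bnd Filter.atTop (nhds 0) := by
    have := ((tendsto_exp_mul_div_sub_atTop hδ0 (exp a)).add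
      (tendsto_exp_mul_div_sub_atTop (by linarith : 0 < 1 - δ) (exp a))).const_mul C
    rw [hbnd]; simpa using this
  have hbB : Filter.Tendsto bnd Filter.atBot (nhds 0) := by
    have := ((tendsto_exp_mul_div_sub_atBot hδ1 (exp_pos a)).add
      (tendsto_exp_mul_div_sub_atBot (by linarith : 1 - δ < 1) (exp_pos a))).const_mul C
    rw [hbnd]; simpa using this
  have hsideT : Filter.Tendsto (fun x : ℝ => ∫ y in (-π)..π, h (x + y * Complex.I))
      Filter.atTop (nhds 0) := by
    refine squeeze_zero_norm' ?_ (by simpa using hbT.mul_const (2 * π))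
    filter_upwards [Filter.eventually_gt_atTop a] with x hx using hside x hx.ne'
  have hsideB : Filter.Tendsto (fun x : ℝ => ∫ y in (-π)..π, h (x + y * Complex.I))
      Filter.atBot (nhds 0) := by
    refine squeeze_zero_norm' ?_ (by simpa using hbB.mul_const (2 * π))
    filter_upwards [Filter.eventually_lt_atBot a] with x hx using hside x hx.ne
  have hintegrable := fun σ (hσ : |σ| ≤ π) => integrable_strip hδ0 hδ1 hd hb a hσ
  have hiT := hintegrable π (by rw [abs_of_pos Real.pi_pos])
  have hiB : Integrable (fun x : ℝ =>
      N (x - π * Complex.I) * ((exp x / (exp x + exp a) : ℝ) : ℂ)) := by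
    have := hintegrable (-π) (by rw [abs_neg, abs_of_pos Real.pi_pos])
    simpa [sub_eq_add_neg] using this
  have hrect : ∀ R : ℝ, (∫ x in (-R)..R, (N (x - π * Complex.I) - N (x + π * Complex.I)) *
      ((exp x / (exp x + exp a) : ℝ) : ℂ)) =
      Complex.I * (∫ y in (-π)..π, h ((-R : ℝ) + y * Complex.I)) -
      Complex.I * ∫ y in (-π)..π, h (R + y * Complex.I) := by
    intro R
    have := Complex.integral_boundary_rect_eq_zero_of_differentiableOn h
      ((-R : ℝ) + (-π : ℝ) * Complex.I) (R + π * Complex.I) (hdiff.mono ?_)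
    · simp only [Complex.add_re, Complex.ofReal_re, Complex.mul_re, Complex.I_re, mul_zero,
        Complex.ofReal_im, Complex.I_im, mul_one, sub_self, add_zero, Complex.add_im,
        Complex.mul_im, zero_add, smul_eq_mul] at this
      have e1 : ∀ x : ℝ, h (x + ((-π : ℝ) : ℂ) * Complex.I) =
          N (x - π * Complex.I) * ((exp x / (exp x + exp a) : ℝ) : ℂ) := by
        intro x
        rw [← hbot]; push_cast; ring_nf
      simp only [e1, htop] at this
      simp_rw [sub_mul]
      rw [intervalIntegral.integral_sub hiB.intervalIntegrable hiT.intervalIntegrable]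
      linear_combination this
    · intro w hw
      have := hw.2
      simp only [Complex.add_im, Complex.ofReal_im, Complex.mul_im, Complex.ofReal_re,
        Complex.I_im, mul_one, Complex.I_re, mul_zero, add_zero, zero_add, mem_preimage,
        uIcc_of_le (by linarith [Real.pi_pos] : -π ≤ π)] at this
      exact abs_le.2 this
  have hl1 := intervalIntegral_tendsto_integral (hiB.sub hiT)
    Filter.tendsto_neg_atTop_atBot Filter.tendsto_id
  have hl2 : Filter.Tendsto (fun R : ℝ => Complex.I * (∫ y in (-π)..π, h ((-R : ℝ) + y * Complex.I)) -
      Complex.I * ∫ y in (-π)..π, h (R + y * Complex.I)) Filter.atTop (nhds 0) := by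
    have := ((hsideB.comp Filter.tendsto_neg_atTop_atBot).const_mul Complex.I).sub
      (hsideT.const_mul Complex.I)
    simpa using this
  have := tendsto_nhds_unique hl1 (hl2.congr fun R => by
    rw [← hrect R]
    simp only [sub_mul, Pi.sub_apply, id])
  simpa only [sub_mul, Pi.sub_apply] using this

lemma exp_half_le (δ x : ℝ) : exp (-(x / 2)) ≤ exp (-δ * x) + exp (-(1 - δ) * x) := by
  have e : exp (-(x / 2)) = exp (-δ * x / 2) * exp (-(1 - δ) * x / 2) := by
    rw [← Real.exp_add]; ring_nf
  have e1 : exp (-δ * x) = exp (-δ * x / 2) ^ 2 := by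
    rw [← Real.exp_nat_mul]; push_cast; ring_nf
  have e2 : exp (-(1 - δ) * x) = exp (-(1 - δ) * x / 2) ^ 2 := by
    rw [← Real.exp_nat_mul]; push_cast; ring_nf
  rw [e, e1, e2]
  nlinarith [sq_nonneg (exp (-δ * x / 2) - exp (-(1 - δ) * x / 2)),
    mul_pos (exp_pos (-δ * x / 2)) (exp_pos (-(1 - δ) * x / 2))]

/-- Cauchy's formula on the strip `|Im w| ≤ π` with the kernel `e^w / (e^w - e^a)`. -/
lemma integral_strip_eq {G : ℂ → ℂ} {C δ : ℝ} (hδ0 : 0 < δ) (hδ1 : δ < 1)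
    (hd : ∀ w : ℂ, |w.im| ≤ π → DifferentiableAt ℂ G w)
    (hb : ∀ w : ℂ, |w.im| ≤ π →
      ‖G w‖ ≤ C * (exp (-δ * w.re) + exp (-(1 - δ) * w.re))) (a : ℝ) :
    ∫ x : ℝ, (G (x - π * Complex.I) - G (x + π * Complex.I)) *
      ((exp x / (exp x + exp a) : ℝ) : ℂ) = 2 * π * Complex.I * G a := by
  set c : ℂ := G a * Complex.exp (a / 2) with hc
  have h0 := integral_strip_eq_zero (N := fun w => G w - c * Complex.exp (-(w / 2)))
    (C := C + ‖c‖) (a := a) hδ0 hδ1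
    (fun w hw => (hd w hw).sub (by fun_prop)) (fun w hw => ?_) ?_
  · have hiT := integrable_strip hδ0 hδ1 hd hb a (σ := π) (by rw [abs_of_pos Real.pi_pos])
    have hiB := integrable_strip hδ0 hδ1 hd hb a (σ := -π)
      (by rw [abs_neg, abs_of_pos Real.pi_pos])
    have hiK : Integrable (fun x : ℝ =>
        (((exp (-(x / 2)) * (exp x / (exp x + exp a)) : ℝ)) : ℂ)) := by
      refine Integrable.ofReal (Integrable.congr
        (integrable_exp_mul_div_add (β := 1 / 2) (by norm_num) (by norm_num) (exp_pos a))
        (ae_of_all _ fun x => ?_))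
      simp only
      congr 2; ring
    have hpt : ∀ x : ℝ, (G (x - π * Complex.I) - c * Complex.exp (-((x - π * Complex.I) / 2)) -
        (G (x + π * Complex.I) - c * Complex.exp (-((x + π * Complex.I) / 2)))) *
        ((exp x / (exp x + exp a) : ℝ) : ℂ) =
        (G (x - π * Complex.I) - G (x + π * Complex.I)) * ((exp x / (exp x + exp a) : ℝ) : ℂ) -
        2 * Complex.I * c * (((exp (-(x / 2)) * (exp x / (exp x + exp a)) : ℝ)) : ℂ) := by
      intro x
      have e1 : Complex.exp (-((x - π * Complex.I) / 2)) = Complex.I * (exp (-(x / 2)) : ℝ) := by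
        rw [show -((x - π * Complex.I) / 2) = π / 2 * Complex.I + ((-(x / 2) : ℝ) : ℂ) by
          push_cast; ring, Complex.exp_add, Complex.exp_pi_div_two_mul_I, Complex.ofReal_exp]
      have e2 : Complex.exp (-((x + π * Complex.I) / 2)) = -Complex.I * (exp (-(x / 2)) : ℝ) := by
        rw [show -((x + π * Complex.I) / 2) = -π / 2 * Complex.I + ((-(x / 2) : ℝ) : ℂ) by
          push_cast; ring, Complex.exp_add, Complex.exp_neg_pi_div_two_mul_I, Complex.ofReal_exp]
      rw [e1, e2, Complex.ofReal_mul]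
      ring
    simp_rw [hpt] at h0
    rw [integral_sub ?_ (hiK.const_mul _), integral_const_mul, integral_complex_ofReal,
      integral_exp_half_div_add, sub_eq_zero] at h0
    · rw [h0, hc]
      push_cast
      rw [show 2 * Complex.I * (G a * Complex.exp (a / 2)) * (π * Complex.exp (-(a / 2))) =
        2 * π * Complex.I * G a * (Complex.exp (a / 2) * Complex.exp (-(a / 2))) by ring,
        ← Complex.exp_add]
      simp
    · refine (hiB.sub hiT).congr (ae_of_all _ fun x => ?_)
      simp only [Pi.sub_apply, Complex.ofReal_neg, neg_mul, ← sub_eq_add_neg]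
      ring
  · refine (norm_sub_le _ _).trans ?_
    rw [norm_mul, Complex.norm_exp, add_mul]
    gcongr
    · exact hb w hw
    · refine le_trans (le_of_eq ?_) (exp_half_le δ w.re)
      simp
  · simp only [hc]
    rw [mul_assoc, ← Complex.exp_add]
    simp

/-- A nonzero finite measure on the order interval `(0, 1)`. -/
structure IsOrderMeasure (ν : Measure ℝ) : Prop where
  finite : IsFiniteMeasure ν
  ae_mem : ∀ᵐ α ∂ν, α ∈ Ioo (0 : ℝ) 1
  ne_zero : ν ≠ 0

namespace IsOrderMeasure

open ProbabilityTheory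

variable {ν : Measure ℝ}

lemma integrable_of_bound (hν : IsOrderMeasure ν) {E : Type*} [NormedAddCommGroup E] {f : ℝ → E}
    (hf : AEStronglyMeasurable f ν) (C : ℝ) (hC : ∀ α ∈ Ioo (0 : ℝ) 1, ‖f α‖ ≤ C) :
    Integrable f ν :=
  have := hν.finite
  Integrable.of_bound hf C (hν.ae_mem.mono hC)

lemma exp_mul_le {α : ℝ} (hα : α ∈ Ioo (0 : ℝ) 1) (x : ℝ) : exp (x * α) ≤ exp |x| := by
  apply exp_le_exp.2
  calc x * α ≤ |x * α| := le_abs_self _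
    _ = |x| * α := by rw [abs_mul, abs_of_pos hα.1]
    _ ≤ |x| := mul_le_of_le_one_right (abs_nonneg x) hα.2.le

lemma integrable_exp_mul (hν : IsOrderMeasure ν) (x : ℝ) :
    Integrable (fun α => exp (x * α)) ν :=
  hν.integrable_of_bound (by fun_prop) (exp |x|) fun α hα => by
    rw [Real.norm_of_nonneg (exp_pos _).le]
    exact exp_mul_le hα x

lemma integrable_mul_exp_mul (hν : IsOrderMeasure ν) {f : ℝ → ℝ} (hf : Continuous f)
    (hf1 : ∀ α, |f α| ≤ 1) (x : ℝ) :
    Integrable (fun α => f α * exp (x * α)) ν :=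
  hν.integrable_of_bound (by fun_prop) (exp |x|) fun α hα => by
    rw [norm_mul, Real.norm_of_nonneg (exp_pos _).le]
    calc _ ≤ 1 * exp |x| := mul_le_mul (hf1 α) (exp_mul_le hα x) (exp_pos _).le zero_le_one
      _ = _ := one_mul _

lemma differentiable_complexMGF (hν : IsOrderMeasure ν) : Differentiable ℂ (complexMGF id ν) := by
  intro w
  have huniv : integrableExpSet id ν = univ := by
    ext x
    simpa [integrableExpSet] using hν.integrable_exp_mul x
  refine (hasDerivAt_complexMGF ?_).differentiableAt
  rw [huniv, interior_univ]
  trivial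

lemma integrable_cexp_mul (hν : IsOrderMeasure ν) (w : ℂ) :
    Integrable (fun α : ℝ => Complex.exp (w * α)) ν :=
  hν.integrable_of_bound (by fun_prop) (exp |w.re|) fun α hα => by
    rw [Complex.norm_exp]
    simpa using exp_mul_le hα w.re

/-- Uniform lower bound for the symbol in the strip `|Im w| ≤ π`. -/
lemma integral_sin_le_norm (hν : IsOrderMeasure ν) {w : ℂ} (hw : |w.im| ≤ π) :
    ∫ α, sin (π * α) * exp (w.re * α) ∂ν ≤ ‖complexMGF id ν w‖ := by
  have h1 : ‖complexMGF id ν w‖ =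
      ‖∫ α : ℝ, Complex.exp (w * α - (w.im / 2 : ℝ) * Complex.I) ∂ν‖ := by
    simp_rw [Complex.exp_sub, div_eq_mul_inv]
    rw [integral_mul_const, norm_mul, norm_inv, Complex.norm_exp_ofReal_mul_I]
    simp [complexMGF]
  have h2 : Integrable (fun α : ℝ => Complex.exp (w * α - (w.im / 2 : ℝ) * Complex.I)) ν := by
    simp_rw [Complex.exp_sub, div_eq_mul_inv]
    exact (hν.integrable_cexp_mul w).mul_const _
  rw [h1]
  refine le_trans ?_ (Complex.re_le_norm _)
  have h3 := integral_re (𝕜 := ℂ) h2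
  simp only [RCLike.re_eq_complex_re] at h3
  rw [← h3]
  refine integral_mono_ae (hν.integrable_mul_exp_mul (by fun_prop)
    (fun α => abs_sin_le_one _) _) h2.re ?_
  filter_upwards [hν.ae_mem] with α hα
  simp only [Complex.exp_re]
  have hre : (w * α - (w.im / 2 : ℝ) * Complex.I).re = w.re * α := by simp
  have him : (w * α - (w.im / 2 : ℝ) * Complex.I).im = w.im * (α - 1 / 2) := by
    simp; ring
  rw [hre, him, mul_comm]
  gcongr
  rw [← Real.cos_abs, ← Real.cos_pi_div_two_sub, ← Real.cos_abs (π / 2 - π * α)]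
  have h4 : |w.im * (α - 1 / 2)| ≤ |π / 2 - π * α| := by
    rw [show π / 2 - π * α = -(π * (α - 1 / 2)) by ring, abs_neg, abs_mul, abs_mul,
      abs_of_pos Real.pi_pos]
    gcongr
  refine Real.cos_le_cos_of_nonneg_of_le_pi (abs_nonneg _) ?_ h4
  rw [abs_le]
  constructor <;> nlinarith [Real.pi_pos, hα.1, hα.2]

lemma exists_integral_sin_ge (hν : IsOrderMeasure ν) : ∃ δ c : ℝ, 0 < δ ∧ δ < 1 ∧ 0 < c ∧
    ∀ x : ℝ, c * min (exp (δ * x)) (exp ((1 - δ) * x)) ≤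
      ∫ α, sin (π * α) * exp (x * α) ∂ν := by
  have := hν.finite
  obtain ⟨n, hn⟩ : ∃ n : ℕ, ν (Icc (1 / (n + 2 : ℝ)) (1 - 1 / (n + 2 : ℝ))) ≠ 0 := by
    by_contra! h
    apply hν.ne_zero
    rw [← Measure.measure_univ_eq_zero]
    have h1 : ν (⋃ n : ℕ, Icc (1 / (n + 2 : ℝ)) (1 - 1 / (n + 2 : ℝ))) = 0 :=
      measure_iUnion_null h
    have h2 := hν.ae_mem
    rw [← nonpos_iff_eq_zero, ← h1]
    refine measure_mono_ae ?_
    filter_upwards [h2] with α hα _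
    obtain ⟨n, hn⟩ := exists_nat_one_div_lt (show (0 : ℝ) < min α (1 - α) from
      lt_min hα.1 (by linarith [hα.2]))
    have h3 : 1 / ((n : ℝ) + 2) ≤ 1 / (n + 1) := by gcongr; norm_num
    exact mem_iUnion.2 ⟨n, by linarith [hn.trans_le (min_le_left _ _)],
      by linarith [hn.trans_le (min_le_right _ _)]⟩
  set δ : ℝ := 1 / (n + 2 : ℝ) with hδ
  have hδ0 : 0 < δ := by positivity
  have hδ1 : δ ≤ 1 / 2 := by
    rw [hδ]
    gcongr
    linarith [(Nat.cast_nonneg n : (0:ℝ) ≤ n)]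
  have hsin : 0 < sin (π * δ) := Real.sin_pos_of_pos_of_lt_pi (by positivity)
    (by nlinarith [Real.pi_pos])
  refine ⟨δ, sin (π * δ) * ν.real (Icc δ (1 - δ)), hδ0, by linarith,
    mul_pos hsin (ENNReal.toReal_pos hn (measure_ne_top _ _)), fun x => ?_⟩
  have hi := hν.integrable_mul_exp_mul (f := fun α => sin (π * α)) (by fun_prop)
    (fun α => abs_sin_le_one _) x
  calc _ = ∫ α in Icc δ (1 - δ), sin (π * δ) * min (exp (δ * x)) (exp ((1 - δ) * x)) ∂ν := by
        rw [setIntegral_const, smul_eq_mul]; ring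
    _ ≤ ∫ α in Icc δ (1 - δ), sin (π * α) * exp (x * α) ∂ν := by
        refine setIntegral_mono_on (integrable_const _) hi.integrableOn measurableSet_Icc ?_
        intro α hα
        have hα0 : 0 < α := hδ0.trans_le hα.1
        have hα1 : α < 1 := by linarith [hα.2]
        refine mul_le_mul ?_ ?_ (by positivity) ?_
        · rw [← Real.cos_pi_div_two_sub, ← Real.cos_pi_div_two_sub,
            ← Real.cos_abs (π / 2 - π * α)]
          refine Real.cos_le_cos_of_nonneg_of_le_pi (abs_nonneg _)
            (by nlinarith [Real.pi_pos]) ?_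
          rw [abs_le]
          constructor <;> nlinarith [Real.pi_pos, hα.1, hα.2]
        · rcases le_total 0 x with hx | hx
          · refine (min_le_left _ _).trans (exp_le_exp.2 ?_)
            nlinarith [hα.1]
          · refine (min_le_right _ _).trans (exp_le_exp.2 ?_)
            nlinarith [hα.2]
        · exact (Real.sin_pos_of_pos_of_lt_pi (by positivity) (by nlinarith [Real.pi_pos])).le
    _ ≤ _ := by
        refine setIntegral_le_integral hi ?_
        filter_upwards [hν.ae_mem] with α hα
        have := (Real.sin_pos_of_pos_of_lt_pi (x := π * α) (mul_pos Real.pi_pos hα.1)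
          (by nlinarith [Real.pi_pos, hα.2])).le
        exact mul_nonneg this (exp_pos _).le

lemma exists_inv_bound (hν : IsOrderMeasure ν) : ∃ δ C : ℝ, 0 < δ ∧ δ < 1 ∧
    ∀ w : ℂ, |w.im| ≤ π → complexMGF id ν w ≠ 0 ∧
      ‖(complexMGF id ν w)⁻¹‖ ≤ C * (exp (-δ * w.re) + exp (-(1 - δ) * w.re)) := by
  obtain ⟨δ, c, hδ0, hδ1, hc, h⟩ := hν.exists_integral_sin_ge
  refine ⟨δ, c⁻¹, hδ0, hδ1, fun w hw => ?_⟩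
  have h1 := (h w.re).trans (hν.integral_sin_le_norm hw)
  have h2 : 0 < c * min (exp (δ * w.re)) (exp ((1 - δ) * w.re)) := by positivity
  refine ⟨norm_pos_iff.1 (h2.trans_le h1), ?_⟩
  rw [norm_inv]
  refine (inv_anti₀ h2 h1).trans ?_
  rw [mul_inv]
  gcongr
  rw [neg_mul, neg_mul, Real.exp_neg, Real.exp_neg]
  rcases min_cases (exp (δ * w.re)) (exp ((1 - δ) * w.re)) with h3 | h3 <;> rw [h3.1]
  · exact le_add_of_nonneg_right (by positivity)
  · exact le_add_of_nonneg_left (by positivity)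

/-- The jump density of `1 / ∫ z^α dν(α)` across the negative half-axis. -/
noncomputable def jump (ν : Measure ℝ) (r : ℝ) : ℝ :=
  (∫ α, sin (π * α) * r ^ α ∂ν) /
    ((∫ α, cos (π * α) * r ^ α ∂ν) ^ 2 + (∫ α, sin (π * α) * r ^ α ∂ν) ^ 2)

lemma jump_nonneg (hν : IsOrderMeasure ν) {r : ℝ} (hr : 0 < r) : 0 ≤ jump ν r := by
  refine div_nonneg (integral_nonneg_of_ae ?_) (by positivity)
  filter_upwards [hν.ae_mem] with α hα
  exact mul_nonneg (Real.sin_pos_of_pos_of_lt_pi (x := π * α) (mul_pos Real.pi_pos hα.1)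
    (by nlinarith [Real.pi_pos, hα.2])).le (Real.rpow_nonneg hr.le _)

lemma stronglyMeasurable_jump (hν : IsOrderMeasure ν) : StronglyMeasurable (jump ν) := by
  have := hν.finite
  have h1 : StronglyMeasurable fun r : ℝ => ∫ α, sin (π * α) * r ^ α ∂ν :=
    StronglyMeasurable.integral_prod_right' (f := fun p : ℝ × ℝ => sin (π * p.2) * p.1 ^ p.2)
      (Measurable.stronglyMeasurable (by fun_prop))
  have h2 : StronglyMeasurable fun r : ℝ => ∫ α, cos (π * α) * r ^ α ∂ν :=
    StronglyMeasurable.integral_prod_right' (f := fun p : ℝ × ℝ => cos (π * p.2) * p.1 ^ p.2)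
      (Measurable.stronglyMeasurable (by fun_prop))
  exact (h1.measurable.div ((h2.measurable.pow_const 2).add
    (h1.measurable.pow_const 2))).stronglyMeasurable

lemma complexMGF_add_mul_I (hν : IsOrderMeasure ν) (x y : ℝ) :
    complexMGF id ν (x + y * Complex.I) =
      (∫ α, cos (y * α) * (exp x) ^ α ∂ν : ℝ) +
        (∫ α, sin (y * α) * (exp x) ^ α ∂ν : ℝ) * Complex.I := by
  have hc := hν.integrable_mul_exp_mul (f := fun α => cos (y * α)) (by fun_prop)
    (fun α => abs_cos_le_one _) x
  have hs := hν.integrable_mul_exp_mul (f := fun α => sin (y * α)) (by fun_prop)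
    (fun α => abs_sin_le_one _) x
  simp_rw [← Real.exp_mul]
  rw [← integral_complex_ofReal, ← integral_complex_ofReal, ← integral_mul_const,
    ← integral_add (by exact_mod_cast hc.ofReal) ((by exact_mod_cast hs.ofReal :
      Integrable (fun α => ((sin (y * α) * exp (x * α) : ℝ) : ℂ)) ν).mul_const _)]
  simp only [complexMGF, id]
  refine integral_congr_ae (ae_of_all _ fun α => ?_)
  simp only
  rw [add_mul, Complex.exp_add, mul_right_comm, Complex.exp_mul_I]
  push_cast
  ring

lemma inv_complexMGF_sub (hν : IsOrderMeasure ν) (x : ℝ) :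
    (complexMGF id ν (x - π * Complex.I))⁻¹ - (complexMGF id ν (x + π * Complex.I))⁻¹ =
      2 * Complex.I * (jump ν (exp x) : ℝ) := by
  obtain ⟨δ, C, -, -, h⟩ := hν.exists_inv_bound
  have hp := (h (x + π * Complex.I) (by simp [abs_of_pos Real.pi_pos])).1
  have hm := (h (x - π * Complex.I) (by simp [abs_of_pos Real.pi_pos])).1
  have e1 := hν.complexMGF_add_mul_I x π
  have e2 := hν.complexMGF_add_mul_I x (-π)
  simp only [neg_mul, Real.cos_neg, Real.sin_neg, integral_neg, Complex.ofReal_neg,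
    ← sub_eq_add_neg] at e2
  rw [jump]
  set c := ∫ α, cos (π * α) * (exp x) ^ α ∂ν
  set s := ∫ α, sin (π * α) * (exp x) ^ α ∂ν
  rw [e1] at hp ⊢
  rw [e2] at hm ⊢
  have hprod : ((c : ℂ) - s * Complex.I) * (c + s * Complex.I) = (c : ℂ) ^ 2 + (s : ℂ) ^ 2 := by
    ring_nf
    rw [Complex.I_sq]
    ring
  rw [inv_sub_inv hm hp, hprod]
  push_cast
  ring

lemma integrable_jump_exp (hν : IsOrderMeasure ν) (a : ℝ) :
    Integrable (fun x : ℝ => jump ν (exp x) * (exp x / (exp x + exp a))) := by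
  obtain ⟨δ, C, hδ0, hδ1, h⟩ := hν.exists_inv_bound
  have hd : ∀ w : ℂ, |w.im| ≤ π → DifferentiableAt ℂ (fun w => (complexMGF id ν w)⁻¹) w :=
    fun w hw => (hν.differentiable_complexMGF w).inv (h w hw).1
  have hT := integrable_strip hδ0 hδ1 hd (fun w hw => (h w hw).2) a (σ := π)
    (by rw [abs_of_pos Real.pi_pos])
  have hB := integrable_strip hδ0 hδ1 hd (fun w hw => (h w hw).2) a (σ := -π)
    (by rw [abs_neg, abs_of_pos Real.pi_pos])
  have h1 := ((hB.sub hT).const_mul (1 / (2 * Complex.I))).re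
  refine h1.congr (ae_of_all _ fun x => ?_)
  simp only [Pi.sub_apply, Complex.ofReal_neg, neg_mul, ← sub_eq_add_neg, ← sub_mul,
    hν.inv_complexMGF_sub]
  rw [show 1 / (2 * Complex.I) * (2 * Complex.I * (jump ν (exp x) : ℂ) *
    ((exp x / (exp x + exp a) : ℝ) : ℂ)) =
    ((jump ν (exp x) * (exp x / (exp x + exp a)) : ℝ) : ℂ) by
      have := Complex.I_ne_zero
      push_cast; field_simp]
  exact Complex.ofReal_re _

lemma integral_jump_exp (hν : IsOrderMeasure ν) (a : ℝ) :
    ∫ x : ℝ, jump ν (exp x) * (exp x / (exp x + exp a)) = π * (∫ α, (exp a) ^ α ∂ν)⁻¹ := by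
  obtain ⟨δ, C, hδ0, hδ1, h⟩ := hν.exists_inv_bound
  have hd : ∀ w : ℂ, |w.im| ≤ π → DifferentiableAt ℂ (fun w => (complexMGF id ν w)⁻¹) w :=
    fun w hw => (hν.differentiable_complexMGF w).inv (h w hw).1
  have h1 := integral_strip_eq hδ0 hδ1 hd (fun w hw => (h w hw).2) a
  simp only [hν.inv_complexMGF_sub, mul_assoc, ← Complex.ofReal_mul] at h1
  rw [integral_const_mul, integral_const_mul, integral_complex_ofReal] at h1
  have h2 := hν.complexMGF_add_mul_I a 0
  simp only [Complex.ofReal_zero, zero_mul, add_zero, Real.cos_zero, one_mul, Real.sin_zero,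
    integral_zero] at h2
  rw [h2] at h1
  have hI := Complex.I_ne_zero
  have h3 : ((∫ x : ℝ, jump ν (exp x) * (exp x / (exp x + exp a)) : ℝ) : ℂ) =
      ((π * (∫ α, (exp a) ^ α ∂ν)⁻¹ : ℝ) : ℂ) := by
    push_cast
    have h4 : (2 * Complex.I) ≠ 0 := by simp
    apply mul_left_cancel₀ h4
    linear_combination h1
  exact_mod_cast h3

lemma integrableOn_jump_div (hν : IsOrderMeasure ν) {s : ℝ} (hs : 0 < s) :
    IntegrableOn (fun r => jump ν r / (r + s)) (Ioi 0) := by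
  rw [← Real.range_exp, ← image_univ, integrableOn_image_iff_integrableOn_abs_deriv_smul
    MeasurableSet.univ (fun x _ => (Real.hasDerivAt_exp x).hasDerivWithinAt) exp_injective.injOn,
    integrableOn_univ]
  have := hν.integrable_jump_exp (Real.log s)
  rw [Real.exp_log hs] at this
  refine this.congr (ae_of_all _ fun x => ?_)
  simp only [smul_eq_mul, abs_of_pos (exp_pos x)]
  ring

/-- Stieltjes representation of `1 / ∫ s^α dν(α)`. -/
lemma integral_jump_div (hν : IsOrderMeasure ν) {s : ℝ} (hs : 0 < s) :
    ∫ r in Ioi 0, jump ν r / (r + s) = π * (∫ α, s ^ α ∂ν)⁻¹ := by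
  rw [← Real.range_exp, ← image_univ, integral_image_eq_integral_abs_deriv_smul
    MeasurableSet.univ (fun x _ => (Real.hasDerivAt_exp x).hasDerivWithinAt) exp_injective.injOn,
    setIntegral_univ]
  have := hν.integral_jump_exp (Real.log s)
  rw [Real.exp_log hs] at this
  rw [← this]
  refine integral_congr_ae (ae_of_all _ fun x => ?_)
  simp only [smul_eq_mul, abs_of_pos (exp_pos x)]
  ring

end IsOrderMeasure

lemma integral_swap_of_nonneg {ρ κ : Measure ℝ} [SFinite ρ] [SFinite κ] {p : ℝ → ℝ → ℝ} {P : ℝ → ℝ}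
    (hm : AEStronglyMeasurable (Function.uncurry p) (κ.prod ρ))
    (hp : ∀ᵐ y ∂ρ, Integrable (fun t => p t y) κ ∧ (0 ≤ᵐ[κ] fun t => p t y) ∧
      ∫ t, p t y ∂κ = P y) (hP : Integrable P ρ) :
    Integrable (fun t => ∫ y, p t y ∂ρ) κ ∧ ∫ t, ∫ y, p t y ∂ρ ∂κ = ∫ y, P y ∂ρ := by
  have hi : Integrable (Function.uncurry p) (κ.prod ρ) := by
    rw [integrable_prod_iff' hm]
    refine ⟨hp.mono fun y hy => hy.1, hP.congr ?_⟩
    filter_upwards [hp] with y hy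
    rw [← hy.2.2]
    refine integral_congr_ae ?_
    filter_upwards [hy.2.1] with t ht
    simpa [Function.uncurry] using (abs_of_nonneg ht).symm
  refine ⟨hi.integral_prod_left, ?_⟩
  rw [integral_integral_swap hi]
  exact integral_congr_ae (hp.mono fun y hy => hy.2.2)

namespace IsOrderMeasure

variable {ν : Measure ℝ}

/-- The kernel `∫ t^(-α) / Γ(1 - α) dν(α)`. -/
noncomputable def kerK (ν : Measure ℝ) (t : ℝ) : ℝ :=
  ∫ α, t ^ (-α) * (Gamma (1 - α))⁻¹ ∂ν

/-- The kernel with Laplace transform `1 / ∫ s^α dν(α)`. -/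
noncomputable def kerG (ν : Measure ℝ) (t : ℝ) : ℝ :=
  (1 / π) * ∫ r in Ioi 0, exp (-r * t) * jump ν r

lemma kerG_nonneg (hν : IsOrderMeasure ν) (t : ℝ) : 0 ≤ kerG ν t :=
  mul_nonneg (by positivity) (setIntegral_nonneg measurableSet_Ioi fun _ hr =>
    mul_nonneg (exp_pos _).le (hν.jump_nonneg hr))

lemma kerK_nonneg (hν : IsOrderMeasure ν) {t : ℝ} (ht : 0 < t) : 0 ≤ kerK ν t := by
  refine integral_nonneg_of_ae ?_
  filter_upwards [hν.ae_mem] with α hα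
  exact mul_nonneg (Real.rpow_nonneg ht.le _)
    (inv_nonneg.2 (Real.Gamma_pos_of_pos (by linarith [hα.2])).le)

lemma laplace_kerG (hν : IsOrderMeasure ν) {s : ℝ} (hs : 0 < s) :
    IntegrableOn (fun t => exp (-s * t) * kerG ν t) (Ioi 0) ∧
      ∫ t in Ioi 0, exp (-s * t) * kerG ν t = (∫ α, s ^ α ∂ν)⁻¹ := by
  have h := integral_swap_of_nonneg (κ := volume.restrict (Ioi 0)) (ρ := volume.restrict (Ioi 0))
    (p := fun t r => exp (-(r + s) * t) * jump ν r) (P := fun r => jump ν r / (r + s)) ?_ ?_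
    (hν.integrableOn_jump_div hs)
  · have e : ∀ t, exp (-s * t) * kerG ν t =
        1 / π * ∫ r in Ioi 0, exp (-(r + s) * t) * jump ν r := by
      intro t
      rw [kerG, mul_left_comm, ← integral_const_mul]
      congr 2
      ext r
      rw [← mul_assoc, ← Real.exp_add]
      ring_nf
    simp_rw [e]
    refine ⟨h.1.const_mul _, ?_⟩
    rw [integral_const_mul, h.2, hν.integral_jump_div hs]
    field_simp
  · refine Measurable.aestronglyMeasurable ?_
    have := hν.stronglyMeasurable_jump.measurable
    simp only [Function.uncurry_def]
    fun_prop
  · filter_upwards [ae_restrict_mem measurableSet_Ioi] with r hr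
    have hrs : -(r + s) < 0 := by linarith [show 0 < r from hr]
    refine ⟨(integrableOn_exp_mul_Ioi hrs 0).mul_const _, ae_of_all _ fun t =>
      mul_nonneg (exp_pos _).le (hν.jump_nonneg hr), ?_⟩
    rw [integral_mul_const, integral_exp_mul_Ioi hrs]
    simp only [mul_zero, Real.exp_zero]
    rw [neg_div_neg_eq]
    ring

lemma laplace_kerK (hν : IsOrderMeasure ν) {s : ℝ} (hs : 0 < s) :
    IntegrableOn (fun t => exp (-s * t) * kerK ν t) (Ioi 0) ∧
      ∫ t in Ioi 0, exp (-s * t) * kerK ν t = (∫ α, s ^ α ∂ν) / s := by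
  have := hν.finite
  have hP : Integrable (fun α => s ^ α / s) ν := by
    have := (hν.integrable_exp_mul (Real.log s)).div_const s
    simpa only [Real.rpow_def_of_pos hs] using this
  have h := integral_swap_of_nonneg (κ := volume.restrict (Ioi 0)) (ρ := ν)
    (p := fun t α => exp (-s * t) * (t ^ (-α) * (Gamma (1 - α))⁻¹)) (P := fun α => s ^ α / s)
    ?_ ?_ hP
  · simp_rw [kerK, ← integral_const_mul, ← integral_div]
    exact h
  · refine Measurable.aestronglyMeasurable ?_
    have : Measurable fun x : ℝ => (Gamma x)⁻¹ := by
      have h1 : Measurable fun x : ℝ => ((Complex.Gamma x)⁻¹).re :=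
        Complex.measurable_re.comp
          ((Complex.differentiable_one_div_Gamma.continuous.comp
            Complex.continuous_ofReal).measurable)
      have e : (fun x : ℝ => (Gamma x)⁻¹) = fun x : ℝ => ((Complex.Gamma x)⁻¹).re := by
        ext x
        rw [Complex.Gamma_ofReal, ← Complex.ofReal_inv, Complex.ofReal_re]
      rwa [e]
    have h2 : Measurable fun p : ℝ × ℝ => (Gamma (1 - p.2))⁻¹ := this.comp (by fun_prop)
    simp only [Function.uncurry_def]
    exact Measurable.mul (by fun_prop) (Measurable.mul (by fun_prop) h2)
  · filter_upwards [hν.ae_mem] with α hα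
    have h1 : 0 < 1 - α := by linarith [hα.2]
    have hG := Real.Gamma_pos_of_pos h1
    have hval : ∫ t in Ioi 0, exp (-s * t) * (t ^ (-α) * (Gamma (1 - α))⁻¹) = s ^ α / s := by
      have := Real.integral_rpow_mul_exp_neg_mul_Ioi h1 hs
      calc _ = (∫ t in Ioi 0, t ^ (1 - α - 1) * exp (-(s * t))) * (Gamma (1 - α))⁻¹ := by
            rw [← integral_mul_const]
            congr 1
            ext t
            rw [show 1 - α - 1 = -α by ring, neg_mul]
            ring
        _ = s ^ α / s := by
            rw [this, mul_assoc, mul_inv_cancel₀ hG.ne', mul_one, one_div, Real.inv_rpow hs.le,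
              Real.rpow_sub hs, Real.rpow_one, inv_div]
    refine ⟨?_, ?_, hval⟩
    · by_contra hni
      rw [integral_undef hni] at hval
      have : 0 < s ^ α / s := by positivity
      exact this.ne hval
    · filter_upwards [ae_restrict_mem measurableSet_Ioi] with t ht
      exact mul_nonneg (exp_pos _).le (mul_nonneg (Real.rpow_nonneg (le_of_lt ht) _)
        (inv_nonneg.2 hG.le))

lemma tendsto_integral_rpow (hν : IsOrderMeasure ν) :
    Filter.Tendsto (fun s : ℝ => (∫ α, s ^ α ∂ν)⁻¹) Filter.atTop (nhds 0) := by
  obtain ⟨δ, c, hδ0, hδ1, hc, h⟩ := hν.exists_integral_sin_ge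
  refine Filter.Tendsto.inv_tendsto_atTop ?_
  have h1 : Filter.Tendsto (fun x : ℝ => c * min (exp (δ * x)) (exp ((1 - δ) * x)))
      Filter.atTop Filter.atTop := by
    refine Filter.Tendsto.const_mul_atTop hc ?_
    refine Filter.tendsto_atTop.2 fun b => ?_
    filter_upwards [(Real.tendsto_exp_atTop.comp
        (Filter.tendsto_id.const_mul_atTop hδ0)).eventually_ge_atTop b,
      (Real.tendsto_exp_atTop.comp (Filter.tendsto_id.const_mul_atTop
        (by linarith : 0 < 1 - δ))).eventually_ge_atTop b] with x h1 h2 using le_min h1 h2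
  have h2 : Filter.Tendsto (fun x : ℝ => ∫ α, exp (x * α) ∂ν) Filter.atTop Filter.atTop := by
    refine Filter.tendsto_atTop_mono (fun x => (h x).trans ?_) h1
    refine integral_mono_of_nonneg ?_ (hν.integrable_exp_mul x) (ae_of_all _ fun α => ?_)
    · filter_upwards [hν.ae_mem] with α hα
      exact mul_nonneg (Real.sin_pos_of_pos_of_lt_pi (x := π * α) (mul_pos Real.pi_pos hα.1)
        (by nlinarith [Real.pi_pos, hα.2])).le (exp_pos _).le
    · exact mul_le_of_le_one_left (exp_pos _).le (sin_le_one _)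
  refine (h2.comp Real.tendsto_log_atTop).congr' ?_
  filter_upwards [Filter.eventually_gt_atTop 0] with s hs
  simp only [Function.comp, Real.rpow_def_of_pos hs]

end IsOrderMeasure

open ProbabilityTheory in
/-- Uniqueness for the two-sided Laplace transform of nonnegative functions. -/
lemma ae_eq_of_laplace_eq {f h : ℝ → ℝ} (hf : ∀ t, 0 ≤ f t) (hh : ∀ t, 0 ≤ h t)
    (hfi : ∀ s > 0, Integrable (fun t => exp (-s * t) * f t))
    (hhi : ∀ s > 0, Integrable (fun t => exp (-s * t) * h t))
    (heq : ∀ s > 0, ∫ t, exp (-s * t) * f t = ∫ t, exp (-s * t) * h t) : f =ᵐ[volume] h := by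
  set M : (ℝ → ℝ) → Measure ℝ := fun f =>
    volume.withDensity fun t => ENNReal.ofReal (exp (-1 * t) * f t) with hM
  have hfin : ∀ f : ℝ → ℝ, (∀ s > 0, Integrable (fun t => exp (-s * t) * f t)) →
      IsFiniteMeasure (M f) := fun f hi =>
    isFiniteMeasure_withDensity_ofReal (hi 1 one_pos).2
  have key : ∀ f : ℝ → ℝ, (∀ t, 0 ≤ f t) → (∀ s > 0, Integrable (fun t => exp (-s * t) * f t)) →
      (∀ x < 1, x ∈ integrableExpSet id (M f)) ∧
      ∀ x < 1, mgf id (M f) x = ∫ t, exp (-(1 - x) * t) * f t := by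
    intro f hf hi
    have hae : AEMeasurable (fun t => (exp (-1 * t) * f t).toNNReal) :=
      (hi 1 one_pos).aestronglyMeasurable.aemeasurable.real_toNNReal
    have e : ∀ x t, (exp (-1 * t) * f t).toNNReal • exp (x * t) = exp (-(1 - x) * t) * f t := by
      intro x t
      rw [NNReal.smul_def, Real.coe_toNNReal _ (mul_nonneg (exp_pos _).le (hf t)), smul_eq_mul,
        mul_right_comm, ← Real.exp_add]
      ring_nf
    refine ⟨fun x hx => ?_, fun x hx => ?_⟩
    · rw [integrableExpSet, mem_ofPred_eq, hM]
      simp only [id]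
      refine (integrable_withDensity_iff_integrable_smul₀ hae).2 ?_
      simp_rw [e]
      exact hi (1 - x) (by linarith)
    · rw [mgf, hM]
      simp only [id]
      refine (integral_withDensity_eq_integral_smul₀ hae _).trans ?_
      simp_rw [e]
  have := hfin f hfi
  have := hfin h hhi
  have hint : ∀ f : ℝ → ℝ, (∀ t, 0 ≤ f t) →
      (∀ s > 0, Integrable (fun t => exp (-s * t) * f t)) →
      AnalyticOnNhd ℂ (complexMGF id (M f)) {z | z.re < 1} := by
    intro f hf hi z hz
    exact analyticAt_complexMGF (interior_maximal (fun x hx => (key f hf hi).1 x hx) isOpen_Iio hz)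
  have hon : EqOn (complexMGF id (M f)) (complexMGF id (M h)) {z | z.re < 1} := by
    refine AnalyticOnNhd.eqOn_of_preconnected_of_frequently_eq (hint f hf hfi) (hint h hh hhi)
      (convex_halfSpace_re_lt 1).isPreconnected (z₀ := ((0 : ℝ) : ℂ)) (by simp) ?_
    have h_real : ∃ᶠ x : ℝ in nhdsWithin 0 {0}ᶜ, complexMGF id (M f) x = complexMGF id (M h) x := by
      refine Filter.Eventually.frequently ?_
      filter_upwards [mem_nhdsWithin_of_mem_nhds (Iio_mem_nhds (zero_lt_one' ℝ))] with x hx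
      rw [complexMGF_ofReal, complexMGF_ofReal, (key f hf hfi).2 x hx, (key h hh hhi).2 x hx,
        heq _ (by linarith [show x < 1 from hx])]
    rw [Filter.frequently_iff_seq_forall] at h_real ⊢
    obtain ⟨xs, hx_tendsto, hx_eq⟩ := h_real
    refine ⟨fun n => xs n, ?_, fun n => by simp [hx_eq]⟩
    rw [tendsto_nhdsWithin_iff] at hx_tendsto ⊢
    exact ⟨(Complex.continuous_ofReal.tendsto 0).comp hx_tendsto.1, by simpa using hx_tendsto.2⟩
  have hmeas : M f = M h := by
    refine Measure.ext_of_charFun ?_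
    ext t
    have := hon (show ((t * Complex.I : ℂ)) ∈ {z : ℂ | z.re < 1} by simp)
    simpa [complexMGF, charFun_apply_real, mul_assoc, mul_comm, mul_left_comm] using this
  have hmf := (hfi 1 one_pos).aestronglyMeasurable.aemeasurable
  have hmh := (hhi 1 one_pos).aestronglyMeasurable.aemeasurable
  have h1 := (withDensity_eq_iff hmf.ennreal_ofReal hmh.ennreal_ofReal
    (hfi 1 one_pos).lintegral_lt_top.ne).1 hmeas
  filter_upwards [h1] with t ht
  rw [ENNReal.ofReal_eq_ofReal_iff (mul_nonneg (exp_pos _).le (hf t))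
    (mul_nonneg (exp_pos _).le (hh t))] at ht
  exact mul_left_cancel₀ (exp_pos _).ne' ht

/-- Convolution of complex-valued functions on the real line. -/
noncomputable def cconv (f g : ℝ → ℂ) : ℝ → ℂ :=
  convolution f g (ContinuousLinearMap.mul ℂ ℂ) volume

section Convolution

variable {f g h : ℝ → ℂ}

lemma cconv_apply (f g : ℝ → ℂ) (x : ℝ) : cconv f g x = ∫ t, f t * g (x - t) := rfl

lemma cconv_comm (f g : ℝ → ℂ) : cconv f g = cconv g f := by
  ext x
  rw [cconv_apply, cconv, convolution_mul_swap]
  simp_rw [mul_comm]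

lemma cconv_congr_left (hf : f =ᵐ[volume] h) : cconv f g = cconv h g :=
  convolution_congr _ hf (Filter.EventuallyEq.refl _ _)

lemma cconv_congr_right (hg : g =ᵐ[volume] h) : cconv f g = cconv f h :=
  convolution_congr _ (Filter.EventuallyEq.refl _ _) hg

lemma integrable_cconv (hf : Integrable f) (hg : Integrable g) : Integrable (cconv f g) :=
  hf.integrable_convolution _ hg

lemma integral_cconv (hf : Integrable f) (hg : Integrable g) :
    ∫ x, cconv f g x = (∫ x, f x) * ∫ x, g x :=
  integral_convolution _ hf hg

/-- The scalar multiple of a constant comes out of the second factor. -/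
lemma cconv_const_mul (c : ℂ) (f g : ℝ → ℂ) :
    cconv f (fun x => c * g x) = fun x => c * cconv f g x := by
  ext x
  simp only [cconv_apply]
  rw [← integral_const_mul]
  congr 1
  ext t
  ring

lemma ae_integrable_cconv (hf : Integrable f) (hg : Integrable g) :
    ∀ᵐ x, Integrable fun t => f t * g (x - t) :=
  hf.ae_convolution_exists (ContinuousLinearMap.mul ℂ ℂ) hg

lemma cconv_add_ae (hf : Integrable f) (hg : Integrable g) (hh : Integrable h) :
    ∀ᵐ x, cconv f (fun t => g t + h t) x = cconv f g x + cconv f h x := by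
  filter_upwards [ae_integrable_cconv hf hg, ae_integrable_cconv hf hh] with x h1 h2
  simp only [cconv_apply, mul_add]
  exact integral_add h1 h2

lemma integrable_norm_conv (hf : Integrable f) (hg : Integrable g) :
    Integrable (fun x => ∫ t, ‖f t‖ * ‖g (x - t)‖) :=
  hf.norm.integrable_convolution (ContinuousLinearMap.mul ℝ ℝ) hg.norm

lemma integral_norm_conv (hf : Integrable f) (hg : Integrable g) :
    ∫ x, ∫ t, ‖f t‖ * ‖g (x - t)‖ = (∫ x, ‖f x‖) * ∫ x, ‖g x‖ :=
  integral_convolution (ContinuousLinearMap.mul ℝ ℝ) hf.norm hg.norm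

lemma norm_cconv_le (f g : ℝ → ℂ) (x : ℝ) : ‖cconv f g x‖ ≤ ∫ t, ‖f t‖ * ‖g (x - t)‖ := by
  rw [cconv_apply]
  refine (norm_integral_le_integral_norm _).trans (le_of_eq ?_)
  simp only [norm_mul]

lemma integral_norm_cconv_le (hf : Integrable f) (hg : Integrable g) :
    ∫ x, ‖cconv f g x‖ ≤ (∫ x, ‖f x‖) * ∫ x, ‖g x‖ := by
  rw [← integral_norm_conv hf hg]
  exact integral_mono (integrable_cconv hf hg).norm (integrable_norm_conv hf hg)
    (norm_cconv_le f g)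

lemma cconv_assoc_ae (hf : Integrable f) (hg : Integrable g) (hh : Integrable h) :
    ∀ᵐ x, cconv (cconv f g) h x = cconv f (cconv g h) x := by
  have h3 := hf.norm.ae_convolution_exists (ContinuousLinearMap.mul ℝ ℝ)
    (hg.norm.integrable_convolution (ContinuousLinearMap.mul ℝ ℝ) hh.norm)
  filter_upwards [h3] with x hx
  exact convolution_assoc _ _ _ _ (fun a b c => mul_assoc a b c) hf.1 hg.1 hh.1
    (hf.ae_convolution_exists _ hg)
    (hg.norm.ae_convolution_exists _ hh.norm) hx

/-- Pointwise commutation of convolutions when one factor is bounded. -/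
lemma cconv_left_comm (hf : Integrable f) (hg : Integrable g) (hh : Integrable h) {C : ℝ}
    (hC : ∀ x, ‖h x‖ ≤ C) (x : ℝ) : cconv f (cconv h g) x = cconv h (cconv f g) x := by
  rw [cconv_comm h g, cconv_comm h]
  symm
  have hC0 : 0 ≤ C := (norm_nonneg _).trans (hC 0)
  refine convolution_assoc _ _ _ _ (fun a b c => mul_assoc a b c) hf.1 hg.1 hh.1
    (hf.ae_convolution_exists _ hg)
    (hg.norm.ae_convolution_exists _ hh.norm) ?_
  have hi := hg.norm.integrable_convolution (ContinuousLinearMap.mul ℝ ℝ) hh.norm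
  have hm : AEStronglyMeasurable (fun t => (convolution (fun x => ‖g x‖) (fun x => ‖h x‖)
      (ContinuousLinearMap.mul ℝ ℝ) volume) (x - t)) volume :=
    hi.1.comp_quasiMeasurePreserving (quasiMeasurePreserving_sub_left_of_right_invariant volume x)
  refine Integrable.mul_bdd (c := (∫ t, ‖g t‖) * C) hf.norm hm (ae_of_all _ fun t => ?_)
  rw [convolution_mul, ← integral_mul_const]
  refine (norm_integral_le_integral_norm _).trans ?_
  refine integral_mono_of_nonneg (ae_of_all _ fun _ => norm_nonneg _) (hg.norm.mul_const _)
    (ae_of_all _ fun s => ?_)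
  simp only [norm_mul, norm_norm]
  exact mul_le_mul_of_nonneg_left (hC _) (norm_nonneg _)

/-- If `g` vanishes almost everywhere on `(-∞, T)` and `f` on `(-∞, 0]`, then `f * g` vanishes
on `(-∞, T)`. -/
lemma cconv_eq_zero_of_lt {T : ℝ} (hf : ∀ t ≤ 0, f t = 0) (hg : ∀ᵐ t, t < T → g t = 0) {x : ℝ}
    (hx : x < T) : cconv f g x = 0 := by
  rw [cconv_apply]
  refine integral_eq_zero_of_ae ?_
  have := (quasiMeasurePreserving_sub_left_of_right_invariant volume x).ae hg
  filter_upwards [this] with t ht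
  rcases le_or_gt t 0 with h0 | h0
  · simp [hf t h0]
  · simp [ht (by linarith)]

end Convolution

/-- The function `t ↦ exp(-σ t) f(t)` extended by zero to `t ≤ 0`. -/
noncomputable def damp (σ : ℝ) (f : ℝ → ℂ) (t : ℝ) : ℂ :=
  if 0 < t then (exp (-σ * t) : ℂ) * f t else 0

lemma damp_of_pos (σ : ℝ) (f : ℝ → ℂ) {t : ℝ} (ht : 0 < t) :
    damp σ f t = (exp (-σ * t) : ℂ) * f t := if_pos ht

lemma damp_of_nonpos (σ : ℝ) (f : ℝ → ℂ) {t : ℝ} (ht : t ≤ 0) : damp σ f t = 0 :=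
  if_neg ht.not_gt

lemma damp_eq_indicator (σ : ℝ) (f : ℝ → ℂ) :
    damp σ f = (Ioi 0).indicator fun t => (exp (-σ * t) : ℂ) * f t := by
  ext t
  simp only [damp, indicator_apply, mem_Ioi]

lemma damp_cconv (σ : ℝ) (f g : ℝ → ℂ) :
    cconv (damp σ f) (damp σ g) = damp σ fun t => ∫ s in (0:ℝ)..t, f (t - s) * g s := by
  ext x
  rw [cconv_comm, cconv_apply]
  rcases le_or_gt x 0 with hx | hx
  · rw [damp_of_nonpos _ _ hx]
    refine integral_eq_zero_of_ae (ae_of_all _ fun t => ?_)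
    rcases le_or_gt t 0 with h0 | h0
    · simp [damp_of_nonpos _ _ h0]
    · simp [damp_of_nonpos σ f (show x - t ≤ 0 by linarith)]
  · rw [damp_of_pos _ _ hx, intervalIntegral.integral_of_le hx.le, integral_Ioc_eq_integral_Ioo,
      ← integral_const_mul, ← integral_indicator measurableSet_Ioo]
    congr 1
    ext t
    by_cases ht : t ∈ Ioo 0 x
    · rw [indicator_of_mem ht, damp_of_pos _ _ ht.1, damp_of_pos _ _ (sub_pos.2 ht.2),
        show -σ * x = -σ * t + -σ * (x - t) by ring, Real.exp_add]
      push_cast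
      ring
    · rw [indicator_of_notMem ht]
      rcases le_or_gt t 0 with h0 | h0
      · simp [damp_of_nonpos _ _ h0]
      · have : x - t ≤ 0 := by
          by_contra hlt
          exact ht ⟨h0, by linarith⟩
        simp [damp_of_nonpos _ _ this]

lemma integrable_damp_iff {σ : ℝ} {f : ℝ → ℂ} :
    Integrable (damp σ f) ↔ IntegrableOn (fun t => (exp (-σ * t) : ℂ) * f t) (Ioi 0) := by
  rw [damp_eq_indicator, integrable_indicator_iff measurableSet_Ioi]

lemma integral_damp (σ : ℝ) (f : ℝ → ℂ) :
    ∫ t, damp σ f t = ∫ t in Ioi 0, (exp (-σ * t) : ℂ) * f t := by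
  rw [damp_eq_indicator, integral_indicator measurableSet_Ioi]

lemma integrable_damp_one {σ : ℝ} (hσ : 0 < σ) : Integrable (damp σ fun _ => 1) := by
  rw [integrable_damp_iff]
  simp only [mul_one]
  exact (integrableOn_exp_mul_Ioi (neg_lt_zero.2 hσ) 0).ofReal

lemma integral_norm_damp (σ : ℝ) (f : ℝ → ℂ) :
    ∫ t, ‖damp σ f t‖ = ∫ t in Ioi 0, exp (-σ * t) * ‖f t‖ := by
  rw [← integral_indicator measurableSet_Ioi, damp_eq_indicator]
  congr 1
  ext t
  by_cases ht : t ∈ Ioi (0:ℝ)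
  · rw [indicator_of_mem ht, indicator_of_mem ht, norm_mul, Complex.norm_real,
      Real.norm_of_nonneg (exp_pos _).le]
  · simp [indicator_of_notMem ht]

/-- Two functions whose Laplace transforms multiply to `1 / s` form a Sonine pair. -/
lemma sonine_of_laplace {K G Φ : ℝ → ℝ} (hK0 : ∀ t > 0, 0 ≤ K t) (hG0 : ∀ t > 0, 0 ≤ G t)
    (hΦ : ∀ s > 0, 0 < Φ s)
    (hK : ∀ s > 0, IntegrableOn (fun t => exp (-s * t) * K t) (Ioi 0) ∧
      ∫ t in Ioi 0, exp (-s * t) * K t = Φ s / s)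
    (hG : ∀ s > 0, IntegrableOn (fun t => exp (-s * t) * G t) (Ioi 0) ∧
      ∫ t in Ioi 0, exp (-s * t) * G t = (Φ s)⁻¹) :
    ∀ᵐ t : ℝ, 0 < t → ∫ s in (0:ℝ)..t, (K (t - s) : ℂ) * G s = 1 := by
  set P : ℝ → ℝ := fun t => ∫ s in (0:ℝ)..t, K (t - s) * G s
  have hP : ∀ t, ∫ s in (0:ℝ)..t, (K (t - s) : ℂ) * G s = P t := by
    intro t
    simp only [P, ← Complex.ofReal_mul]
    exact intervalIntegral.integral_ofReal
  have hP0 : ∀ t > 0, 0 ≤ P t := by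
    intro t ht
    simp only [P]
    rw [intervalIntegral.integral_of_le ht.le, integral_Ioc_eq_integral_Ioo]
    exact setIntegral_nonneg measurableSet_Ioo fun s hs =>
      mul_nonneg (hK0 _ (sub_pos.2 hs.2)) (hG0 _ hs.1)
  have e : ∀ (F : ℝ → ℝ) (s t : ℝ), damp s (fun t => (F t : ℂ)) t =
      ((exp (-s * t) * (Ioi 0).indicator F t : ℝ) : ℂ) := by
    intro F s t
    by_cases ht : 0 < t
    · rw [damp_of_pos _ _ ht, indicator_of_mem (mem_Ioi.2 ht)]
      push_cast
      rfl
    · rw [damp_of_nonpos _ _ (not_lt.1 ht), indicator_of_notMem (by simpa using ht)]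
      simp
  have hi : ∀ (F : ℝ → ℝ) (s : ℝ), IntegrableOn (fun t => exp (-s * t) * F t) (Ioi 0) →
      Integrable (damp s fun t => (F t : ℂ)) := by
    intro F s h
    rw [integrable_damp_iff]
    exact_mod_cast h.ofReal (𝕜 := ℂ)
  have hv : ∀ (F : ℝ → ℝ) (s : ℝ), ∫ t, damp s (fun t => (F t : ℂ)) t =
      ((∫ t in Ioi 0, exp (-s * t) * F t : ℝ) : ℂ) := by
    intro F s
    simp only [integral_damp, ← Complex.ofReal_mul]
    exact integral_ofReal
  have hconv : ∀ s, cconv (damp s fun t => (K t : ℂ)) (damp s fun t => (G t : ℂ)) =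
      damp s fun t => (P t : ℂ) := by
    intro s
    rw [damp_cconv]
    simp_rw [hP]
  have hPi : ∀ s > 0, Integrable (damp s fun t => (P t : ℂ)) := fun s hs => by
    rw [← hconv]
    exact integrable_cconv (hi K s (hK s hs).1) (hi G s (hG s hs).1)
  have h1i : ∀ s > 0, Integrable (damp s fun _ => ((1:ℝ) : ℂ)) := fun s hs => by
    simpa using integrable_damp_one hs
  have hr : ∀ (F : ℝ → ℝ) (s : ℝ), Integrable (damp s fun t => (F t : ℂ)) →
      Integrable (fun t => exp (-s * t) * (Ioi 0).indicator F t) := by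
    intro F s h
    have := h.re
    simpa only [e, RCLike.re_to_complex, Complex.ofReal_re] using this
  have hrv : ∀ (F : ℝ → ℝ) (s : ℝ), ((∫ t, exp (-s * t) * (Ioi 0).indicator F t : ℝ) : ℂ) =
      ∫ t, damp s (fun t => (F t : ℂ)) t := by
    intro F s
    simp_rw [e]
    exact integral_ofReal.symm
  have key := ae_eq_of_laplace_eq (f := (Ioi 0).indicator P) (h := (Ioi 0).indicator fun _ => 1)
    (fun t => indicator_nonneg (fun t ht => hP0 t ht) t)
    (fun t => indicator_nonneg (fun t ht => zero_le_one) t)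
    (fun s hs => hr P s (hPi s hs)) (fun s hs => hr _ s (h1i s hs)) (fun s hs => by
      have h1 : (∫ t, damp s (fun t => (P t : ℂ)) t) = ∫ t, damp s (fun t => ((1:ℝ) : ℂ)) t := by
        rw [← hconv, integral_cconv (hi K s (hK s hs).1) (hi G s (hG s hs).1), hv, hv, hv,
          (hK s hs).2, (hG s hs).2, ← Complex.ofReal_mul]
        congr 1
        simp only [mul_one]
        rw [integral_exp_mul_Ioi (neg_lt_zero.2 hs)]
        have := (hΦ s hs).ne'
        simp
        field_simp
      rw [← hrv, ← hrv] at h1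
      exact_mod_cast h1)
  filter_upwards [key] with t ht h0
  rw [indicator_of_mem (mem_Ioi.2 h0), indicator_of_mem (mem_Ioi.2 h0)] at ht
  rw [hP, ht, Complex.ofReal_one]

section Series

variable {F : ℕ → ℝ → ℂ}

lemma ae_summable_norm (hF : ∀ n, Integrable (F n)) (hs : Summable fun n => ∫ x, ‖F n x‖) :
    (∀ᵐ x, Summable fun n => ‖F n x‖) ∧ Integrable fun x => ∑' n, F n x := by
  have h1 : ∑' n, ∫⁻ x, ‖F n x‖ₑ ≠ ⊤ := by
    simp_rw [← fun n => ofReal_integral_norm_eq_lintegral_enorm (hF n)]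
    exact hs.tsum_ofReal_ne_top
  have hm : ∀ n, AEMeasurable fun x => ‖F n x‖ₑ := fun n => (hF n).1.enorm
  have h2 : ∫⁻ x, ∑' n, ‖F n x‖ₑ ≠ ⊤ := by rwa [lintegral_tsum hm]
  have h3 : ∀ᵐ x, Summable fun n => ‖F n x‖ := by
    filter_upwards [ae_lt_top' (AEMeasurable.tsum hm) h2] with x hx
    have := (ENNReal.tsum_coe_ne_top_iff_summable (f := fun n => ‖F n x‖₊)).1 hx.ne
    exact NNReal.summable_coe.2 this
  refine ⟨h3, ?_, ?_⟩
  · refine aestronglyMeasurable_of_tendsto_ae Filter.atTop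
      (f := fun n x => ∑ i ∈ Finset.range n, F i x) (fun n => ?_) ?_
    · exact Finset.aestronglyMeasurable_fun_sum _ fun i _ => (hF i).1
    · filter_upwards [h3] with x hx using hx.of_norm.hasSum.tendsto_sum_nat
  · refine lt_of_le_of_lt (lintegral_mono_ae ?_) h2.lt_top
    filter_upwards [h3] with x hx
    rw [← ofReal_norm]
    refine (ENNReal.ofReal_le_ofReal (norm_tsum_le_tsum_norm hx)).trans ?_
    rw [ENNReal.ofReal_tsum_of_nonneg (fun _ => norm_nonneg _) hx]
    simp_rw [ofReal_norm]
    exact le_rfl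

lemma cconv_tsum_ae {f : ℝ → ℂ} (hf : Integrable f) (hF : ∀ n, Integrable (F n))
    (hs : Summable fun n => ∫ x, ‖F n x‖) :
    ∀ᵐ x, cconv f (fun x => ∑' n, F n x) x = ∑' n, cconv f (F n) x := by
  have h1 : ∀ᵐ x, Summable fun n => ∫ t, ‖f t‖ * ‖F n (x - t)‖ := by
    have := (ae_summable_norm (F := fun n x => ((∫ t, ‖f t‖ * ‖F n (x - t)‖ : ℝ) : ℂ))
      (fun n => (integrable_norm_conv hf (hF n)).ofReal) ?_).1
    · filter_upwards [this] with x hx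
      refine hx.congr fun n => ?_
      rw [Complex.norm_real, Real.norm_of_nonneg]
      exact integral_nonneg fun t => by positivity
    · refine (hs.mul_left (∫ x, ‖f x‖)).congr fun n => ?_
      rw [← integral_norm_conv hf (hF n)]
      refine integral_congr_ae (ae_of_all _ fun x => ?_)
      simp only [Complex.norm_real]
      rw [Real.norm_of_nonneg]
      exact integral_nonneg fun t => by positivity
  have h2 : ∀ᵐ x, ∀ n, Integrable fun t => f t * F n (x - t) :=
    ae_all_iff.2 fun n => ae_integrable_cconv hf (hF n)
  filter_upwards [h1, h2] with x hx1 hx2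
  simp only [cconv_apply, ← tsum_mul_left]
  refine (hasSum_integral_of_summable_integral_norm hx2 ?_).tsum_eq.symm
  simpa only [norm_mul] using hx1

end Series

/-- Iterated convolution powers, `cconvPow f n` being the `(n + 1)`-fold convolution of `f`. -/
noncomputable def cconvPow (f : ℝ → ℂ) : ℕ → ℝ → ℂ
  | 0 => f
  | n + 1 => cconv f (cconvPow f n)

lemma integrable_cconvPow {f : ℝ → ℂ} (hf : Integrable f) (n : ℕ) : Integrable (cconvPow f n) := by
  induction n with
  | zero => exact hf
  | succ n ih => exact integrable_cconv hf ih

lemma integral_norm_cconvPow_le {f : ℝ → ℂ} (hf : Integrable f) (n : ℕ) :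
    ∫ x, ‖cconvPow f n x‖ ≤ (∫ x, ‖f x‖) ^ (n + 1) := by
  induction n with
  | zero => simp [cconvPow]
  | succ n ih =>
    refine (integral_norm_cconv_le hf (integrable_cconvPow hf n)).trans ?_
    rw [pow_succ' _ (n + 1)]
    exact mul_le_mul_of_nonneg_left ih (integral_nonneg fun _ => norm_nonneg _)

section Resolvent

variable {k g h : ℝ → ℂ} {lam : ℂ}

lemma summable_integral_norm_cconvPow (hg : Integrable g) (hq : ‖lam‖ * ∫ x, ‖g x‖ < 1) :
    Summable fun n => ∫ x, ‖(-lam) ^ (n + 1) * cconvPow g n x‖ := by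
  have hq0 : 0 ≤ ‖lam‖ * ∫ x, ‖g x‖ :=
    mul_nonneg (norm_nonneg _) (integral_nonneg fun _ => norm_nonneg _)
  have := (summable_nat_add_iff 1).2 (summable_geometric_of_lt_one hq0 hq)
  refine this.of_nonneg_of_le (fun n => integral_nonneg fun _ => norm_nonneg _) fun n => ?_
  simp only [norm_mul, norm_pow, norm_neg]
  rw [integral_const_mul, mul_pow]
  exact mul_le_mul_of_nonneg_left (integral_norm_cconvPow_le hg n) (by positivity)

/-- The Neumann series `∑ (-lam)^n g^[n]`, `n ≥ 1`. -/
noncomputable def neumann (lam : ℂ) (g : ℝ → ℂ) (x : ℝ) : ℂ :=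
  ∑' n : ℕ, (-lam) ^ (n + 1) * cconvPow g n x

lemma integrable_neumann (hg : Integrable g) (hq : ‖lam‖ * ∫ x, ‖g x‖ < 1) :
    Integrable (neumann lam g) :=
  (ae_summable_norm (fun n => (integrable_cconvPow hg n).const_mul _)
    (summable_integral_norm_cconvPow hg hq)).2

lemma neumann_eq_ae (hg : Integrable g) (hq : ‖lam‖ * ∫ x, ‖g x‖ < 1) :
    ∀ᵐ x, neumann lam g x = -lam * (g x + cconv g (neumann lam g) x) := by
  have hi : ∀ n, Integrable fun x => (-lam) ^ (n + 1) * cconvPow g n x :=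
    fun n => (integrable_cconvPow hg n).const_mul _
  have hs := summable_integral_norm_cconvPow hg hq
  filter_upwards [(ae_summable_norm hi hs).1, cconv_tsum_ae hg hi hs] with x h1 h2
  have h3 : cconv g (neumann lam g) x = _ := h2
  rw [h3, neumann, h1.of_norm.tsum_eq_zero_add, mul_add, ← tsum_mul_left]
  simp only [zero_add, pow_one, cconvPow]
  congr 1
  refine tsum_congr fun n => ?_
  rw [cconv_const_mul, pow_succ' _ (n + 1)]
  ring

lemma cconv_neumann_ae (hk : Integrable k) (hg : Integrable g) (hh : cconv k g =ᵐ[volume] h)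
    (hq : ‖lam‖ * ∫ x, ‖g x‖ < 1) :
    ∀ᵐ x, cconv k (neumann lam g) x = -lam * (h x + cconv h (neumann lam g) x) := by
  have hN := integrable_neumann hg hq
  filter_upwards [cconv_add_ae hk hg (integrable_cconv hg hN), cconv_assoc_ae hk hg hN, hh]
    with x h1 h2 h3
  rw [cconv_congr_right (neumann_eq_ae hg hq), cconv_const_mul]
  dsimp only
  rw [h1, h3, ← h2, cconv_congr_left hh]

lemma cconv_eq_zero_of_resolvent {f : ℝ → ℂ} {T : ℝ} (hg0 : ∀ t ≤ 0, g t = 0)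
    (hk : Integrable k) (hg : Integrable g) (hf : Integrable f) (hh : cconv k g =ᵐ[volume] h)
    (hq : ‖lam‖ * ∫ x, ‖g x‖ < 1)
    (heq : ∀ᵐ t, t < T → cconv k f t + lam * cconv h f t = 0) :
    ∀ᵐ t, t < T → cconv h f t = 0 := by
  have hhi : Integrable h := (integrable_cconv hk hg).congr hh
  set U := cconv h f with hU
  have hUi : Integrable U := integrable_cconv hhi hf
  set V := (Iio T).indicator U with hV
  have hVi : Integrable V := hUi.indicator measurableSet_Iio
  have hgV : ∀ t < T, cconv g V t = cconv g U t := by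
    intro t ht
    simp only [cconv_apply]
    congr 1
    ext s
    rcases le_or_gt s 0 with h0 | h0
    · simp [hg0 s h0]
    · rw [hV, indicator_of_mem (mem_Iio.2 (by linarith))]
  have hle : ∀ᵐ t, ‖V t‖ ≤ ‖lam‖ * ‖cconv g V t‖ := by
    filter_upwards [cconv_add_ae hg (integrable_cconv hk hf) (hUi.const_mul lam),
      cconv_assoc_ae hg hk hf] with t h1 h2
    by_cases ht : t < T
    · rw [cconv_eq_zero_of_lt hg0 heq ht, cconv_const_mul, ← h2, cconv_comm g k,
        cconv_congr_left hh, ← hU] at h1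
      rw [hgV t ht, hV, indicator_of_mem (mem_Iio.2 ht), ← norm_mul, ← norm_neg (lam * _)]
      exact le_of_eq (congrArg norm (eq_neg_of_add_eq_zero_left h1.symm))
    · rw [hV, indicator_of_notMem (by simpa using ht), norm_zero]
      positivity
  have h1 : ∫ t, ‖V t‖ ≤ (‖lam‖ * ∫ t, ‖g t‖) * ∫ t, ‖V t‖ := by
    refine (integral_mono_ae hVi.norm ((integrable_cconv hg hVi).norm.const_mul _) hle).trans ?_
    rw [integral_const_mul, mul_assoc]
    exact mul_le_mul_of_nonneg_left (integral_norm_cconv_le hg hVi) (norm_nonneg _)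
  have h2 : ∫ t, ‖V t‖ = 0 := by
    have h0 : 0 ≤ ∫ t, ‖V t‖ := integral_nonneg fun _ => norm_nonneg _
    nlinarith
  rw [integral_eq_zero_iff_of_nonneg (fun _ => norm_nonneg _) hVi.norm] at h2
  filter_upwards [h2] with t ht hlt
  rw [hV] at ht
  simpa [indicator_of_mem (mem_Iio.2 hlt)] using ht

end Resolvent

section Damped

variable {σ T : ℝ} {f : ℝ → ℂ}

lemma integrableOn_of_damp (hf : Integrable (damp σ f)) : IntegrableOn f (Ioc 0 T) := by
  have h := (integrable_damp_iff.1 hf).mono_set (Ioc_subset_Ioi_self : Ioc 0 T ⊆ Ioi 0)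
  have h2 : IntegrableOn (fun t : ℝ => (exp (σ * t) : ℂ) * ((exp (-σ * t) : ℂ) * f t))
      (Ioc 0 T) :=
    h.continuousOn_mul_of_subset (K := Icc 0 T) (by fun_prop) isCompact_Icc measurableSet_Ioc Ioc_subset_Icc_self
  refine h2.congr (ae_of_all _ fun t => ?_)
  dsimp only
  rw [← mul_assoc, ← Complex.ofReal_mul, ← Real.exp_add]
  simp

lemma integral_norm_le_damp (hσ : 0 < σ) (hf : Integrable (damp σ f)) :
    ∫ t in Ioc 0 T, ‖f t‖ ≤ exp (σ * T) * ∫ t, ‖damp σ f t‖ := by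
  refine le_trans ?_ (mul_le_mul_of_nonneg_left (setIntegral_le_integral
    (s := Ioc 0 T) hf.norm (ae_of_all _ fun _ => norm_nonneg _)) (exp_pos _).le)
  rw [← integral_const_mul]
  refine setIntegral_mono_on (integrableOn_of_damp hf).norm (hf.norm.integrableOn.const_mul _)
    measurableSet_Ioc fun t ht => ?_
  rw [damp_of_pos _ _ ht.1, norm_mul, Complex.norm_real, Real.norm_of_nonneg (exp_pos _).le,
    ← mul_assoc, ← Real.exp_add]
  exact le_mul_of_one_le_left (norm_nonneg _) (Real.one_le_exp (by nlinarith [ht.2]))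

lemma integrable_damp_indicator (hf : IntegrableOn f (Ioc 0 T)) :
    Integrable (damp σ ((Iio T).indicator f)) := by
  have h2 : IntegrableOn (fun t : ℝ => (exp (-σ * t) : ℂ) * f t) (Ioc 0 T) :=
    hf.continuousOn_mul_of_subset (K := Icc 0 T) (by fun_prop) isCompact_Icc measurableSet_Ioc Ioc_subset_Icc_self
  refine ((h2.mono_set Ioo_subset_Ioc_self).integrable_indicator measurableSet_Ioo).congr
    (ae_of_all _ fun t => ?_)
  by_cases h0 : 0 < t
  · rw [damp_of_pos _ _ h0]
    by_cases h1 : t < T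
    · rw [indicator_of_mem (show t ∈ Ioo 0 T from ⟨h0, h1⟩), indicator_of_mem (mem_Iio.2 h1)]
    · rw [indicator_of_notMem (fun h => h1 h.2), indicator_of_notMem (by simpa using h1), mul_zero]
  · rw [damp_of_nonpos _ _ (not_lt.1 h0), indicator_of_notMem (fun h => h0 h.1)]

lemma cconv_damp_indicator (k f : ℝ → ℂ) {t : ℝ} (h0 : 0 < t) (hT : t < T) :
    cconv (damp σ k) (damp σ ((Iio T).indicator f)) t =
      (exp (-σ * t) : ℂ) * ∫ s in (0:ℝ)..t, k (t - s) * f s := by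
  rw [damp_cconv, damp_of_pos _ _ h0]
  congr 1
  refine intervalIntegral.integral_congr fun s hs => ?_
  rw [uIcc_of_le h0.le] at hs
  rw [indicator_of_mem (mem_Iio.2 (hs.2.trans_lt hT))]

end Damped

section IteratedKernels

variable {σ : ℝ} {G : ℝ → ℝ}

lemma damp_convD (σ : ℝ) (G : ℝ → ℝ) (n : ℕ) :
    damp σ (fun t => (convD G (n + 1) t : ℂ)) = cconvPow (damp σ fun t => (G t : ℂ)) n := by
  induction n with
  | zero => rfl
  | succ n ih =>
    rw [cconvPow, ← ih, damp_cconv]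
    congr 1
    ext t
    simp only [← Complex.ofReal_mul]
    exact intervalIntegral.integral_ofReal.symm

lemma damp_conv1_succ (σ : ℝ) (G : ℝ → ℝ) (n : ℕ) :
    damp σ (fun t => (conv1 G (n + 1) t : ℂ)) =
      cconv (damp σ fun t => (G t : ℂ)) (damp σ fun t => (conv1 G n t : ℂ)) := by
  rw [damp_cconv]
  congr 1
  ext t
  simp only [← Complex.ofReal_mul]
  exact intervalIntegral.integral_ofReal.symm

lemma norm_damp_one_le (hσ : 0 < σ) (t : ℝ) : ‖damp σ (fun _ => 1) t‖ ≤ 1 := by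
  rcases le_or_gt t 0 with h | h
  · simp [damp_of_nonpos _ _ h]
  · rw [damp_of_pos _ _ h, mul_one, Complex.norm_real, Real.norm_of_nonneg (exp_pos _).le]
    exact Real.exp_le_one_iff.2 (by nlinarith)

lemma damp_conv1 (hσ : 0 < σ) (hG : Integrable (damp σ fun t => (G t : ℂ))) (n : ℕ) :
    damp σ (fun t => (conv1 G (n + 1) t : ℂ)) =
      cconv (damp σ fun _ => 1) (cconvPow (damp σ fun t => (G t : ℂ)) n) := by
  induction n with
  | zero =>
    rw [damp_conv1_succ, cconv_comm, cconvPow]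
    simp [conv1]
  | succ n ih =>
    rw [damp_conv1_succ, ih, cconvPow]
    ext x
    exact cconv_left_comm hG (integrable_cconvPow hG n) (integrable_damp_one hσ)
      (norm_damp_one_le hσ) x

lemma conv1_eq_integral (hσ : 0 < σ) (hG : Integrable (damp σ fun t => (G t : ℂ))) (n : ℕ)
    {t : ℝ} (ht : 0 ≤ t) : (conv1 G (n + 1) t : ℂ) = ∫ s in (0:ℝ)..t, (convD G (n + 1) s : ℂ) := by
  rcases ht.eq_or_lt with rfl | ht
  · simp [conv1]
  · have h := congrFun (damp_conv1 hσ hG n) t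
    rw [← damp_convD, damp_cconv, damp_of_pos _ _ ht, damp_of_pos _ _ ht] at h
    simpa using h

lemma summable_neumann_series {lam : ℂ} (hσ : 0 < σ)
    (hG : Integrable (damp σ fun t => (G t : ℂ)))
    (hq : ‖lam‖ * ∫ t, ‖damp σ (fun t => (G t : ℂ)) t‖ < 1) {T : ℝ} (hT : 0 < T) :
    Summable (fun n : ℕ => ‖lam‖ ^ n *
      ((∫ t in (0:ℝ)..T, |conv1 G n t|) + ∫ t in (0:ℝ)..T, |convD G n t|)) := by
  rw [← summable_nat_add_iff 1]
  set q := ∫ t, ‖damp σ (fun t => (G t : ℂ)) t‖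
  have hq0 : 0 ≤ q := integral_nonneg fun _ => norm_nonneg _
  set N := ∫ t, ‖damp σ (fun _ => 1) t‖
  have hN0 : 0 ≤ N := integral_nonneg fun _ => norm_nonneg _
  have hs := ((summable_nat_add_iff 1).2 (summable_geometric_of_lt_one
    (mul_nonneg (norm_nonneg lam) hq0) hq)).mul_left (exp (σ * T) * (N + 1))
  have h0 : ∀ f : ℝ → ℝ, 0 ≤ ∫ t in (0:ℝ)..T, |f t| := fun f =>
    intervalIntegral.integral_nonneg hT.le fun _ _ => abs_nonneg _
  refine hs.of_nonneg_of_le (fun n => mul_nonneg (by positivity) (add_nonneg (h0 _) (h0 _)))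
    fun n => ?_
  have hp := integrable_cconvPow hG n
  have h1 : ∫ t in (0:ℝ)..T, |convD G (n + 1) t| ≤ exp (σ * T) * q ^ (n + 1) := by
    have := integral_norm_le_damp (T := T) hσ (f := fun t => (convD G (n + 1) t : ℂ))
      (by rwa [damp_convD])
    rw [damp_convD] at this
    rw [intervalIntegral.integral_of_le hT.le]
    simp only [Complex.norm_real, Real.norm_eq_abs] at this
    exact this.trans (mul_le_mul_of_nonneg_left (integral_norm_cconvPow_le hG n) (exp_pos _).le)
  have h2 : ∫ t in (0:ℝ)..T, |conv1 G (n + 1) t| ≤ exp (σ * T) * (N * q ^ (n + 1)) := by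
    have := integral_norm_le_damp (T := T) hσ (f := fun t => (conv1 G (n + 1) t : ℂ))
      (by rw [damp_conv1 hσ hG]; exact integrable_cconv (integrable_damp_one hσ) hp)
    rw [damp_conv1 hσ hG] at this
    rw [intervalIntegral.integral_of_le hT.le]
    simp only [Complex.norm_real, Real.norm_eq_abs] at this
    refine this.trans (mul_le_mul_of_nonneg_left ?_ (exp_pos _).le)
    exact (integral_norm_cconv_le (integrable_damp_one hσ) hp).trans
      (mul_le_mul_of_nonneg_left (integral_norm_cconvPow_le hG n) hN0)
  calc _ ≤ ‖lam‖ ^ (n + 1) * (exp (σ * T) * (N * q ^ (n + 1)) + exp (σ * T) * q ^ (n + 1)) := by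
        gcongr
    _ = _ := by
        rw [mul_pow]
        ring

end IteratedKernels

section Volterra

variable {σ : ℝ} {K G : ℝ → ℝ} {lam : ℂ}

lemma exists_solution (hσ : 0 < σ) (hK : Integrable (damp σ fun t => (K t : ℂ)))
    (hG : Integrable (damp σ fun t => (G t : ℂ)))
    (hS : cconv (damp σ fun t => (K t : ℂ)) (damp σ fun t => (G t : ℂ))
      =ᵐ[volume] damp σ fun _ => 1)
    (hq : ‖lam‖ * ∫ t, ‖damp σ (fun t => (G t : ℂ)) t‖ < 1) (v₀ : ℂ) {T : ℝ} (hT : 0 < T) :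
    ∃ v : ℝ → ℂ, ∃ v' : ℝ → ℂ,
      IntervalIntegrable v' volume 0 T ∧
      v 0 = v₀ ∧
      (∀ t ∈ Icc (0:ℝ) T, v t = v₀ + ∫ s in (0:ℝ)..t, v' s) ∧
      (∀ᵐ t ∂(volume.restrict (Ioo 0 T)),
        (∫ τ in (0:ℝ)..t, (K (t - τ) : ℂ) * v' τ) + lam * v t = 0) ∧
      (∀ t ∈ Icc (0:ℝ) T, v t = v₀ * ∑' n : ℕ, (-lam) ^ n * (conv1 G n t : ℂ)) := by
  set Ψ : ℝ → ℂ := fun t => ∑' n : ℕ, (-lam) ^ (n + 1) * (convD G (n + 1) t : ℂ) with hΨ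
  have hdamp : damp σ Ψ = neumann lam (damp σ fun t => (G t : ℂ)) := by
    ext t
    simp only [neumann, ← damp_convD]
    rcases le_or_gt t 0 with h | h
    · simp [damp_of_nonpos _ _ h]
    · simp only [damp_of_pos _ _ h, hΨ]
      rw [← tsum_mul_left]
      exact tsum_congr fun n => by ring
  have hΨi : ∀ t, IntegrableOn Ψ (Ioc 0 t) := fun t =>
    integrableOn_of_damp (σ := σ) (hdamp ▸ integrable_neumann hG hq)
  refine ⟨fun t => v₀ + ∫ s in (0:ℝ)..t, v₀ * Ψ s, fun t => v₀ * Ψ t, ?_, by simp,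
    fun _ _ => rfl, ?_, fun t ht => ?_⟩
  · rw [intervalIntegrable_iff_integrableOn_Ioc_of_le hT.le]
    exact (hΨi T).const_mul v₀
  · rw [ae_restrict_iff' measurableSet_Ioo]
    filter_upwards [cconv_neumann_ae hK hG hS hq] with t h ht
    rw [← hdamp, damp_cconv, damp_cconv, damp_of_pos _ _ ht.1, damp_of_pos _ _ ht.1,
      damp_of_pos _ _ ht.1] at h
    simp only [one_mul, mul_one] at h
    have he : (exp (-σ * t) : ℂ) ≠ 0 := by exact_mod_cast (exp_pos _).ne'
    have h2 : ∫ s in (0:ℝ)..t, (K (t - s) : ℂ) * Ψ s = -lam * (1 + ∫ s in (0:ℝ)..t, Ψ s) := by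
      apply mul_left_cancel₀ he
      rw [h]
      ring
    simp only [mul_left_comm _ v₀, intervalIntegral.integral_const_mul]
    rw [h2]
    ring
  · have hD : ∀ n, IntegrableOn (fun s => (-lam) ^ (n + 1) * (convD G (n + 1) s : ℂ)) (Ioc 0 t) :=
      fun n => (integrableOn_of_damp (σ := σ)
        (by rw [damp_convD]; exact integrable_cconvPow hG n)).const_mul _
    have hsum : Summable fun n : ℕ =>
        ∫ s in Ioc 0 t, ‖(-lam) ^ (n + 1) * (convD G (n + 1) s : ℂ)‖ := by
      have hs1 := (summable_integral_norm_cconvPow hG hq).mul_left (exp (σ * t))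
      refine hs1.of_nonneg_of_le (fun n => integral_nonneg fun _ => norm_nonneg _) fun n => ?_
      have := integral_norm_le_damp (T := t) hσ (f := fun t => (convD G (n + 1) t : ℂ))
        (by rw [damp_convD]; exact integrable_cconvPow hG n)
      rw [damp_convD] at this
      simp only [norm_mul, integral_const_mul]
      rw [mul_left_comm]
      exact mul_le_mul_of_nonneg_left this (norm_nonneg _)
    have hhas := hasSum_integral_of_summable_integral_norm hD hsum
    have hc : ∀ n, ∫ s in Ioc 0 t, (-lam) ^ (n + 1) * (convD G (n + 1) s : ℂ) =
        (-lam) ^ (n + 1) * (conv1 G (n + 1) t : ℂ) := fun n => by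
      rw [integral_const_mul, conv1_eq_integral hσ hG n ht.1,
        intervalIntegral.integral_of_le ht.1]
    simp only [hc] at hhas
    have hsm : Summable fun n : ℕ => (-lam) ^ n * (conv1 G n t : ℂ) :=
      (summable_nat_add_iff 1).1 hhas.summable
    dsimp only
    rw [hsm.tsum_eq_zero_add, hhas.tsum_eq, intervalIntegral.integral_const_mul,
      intervalIntegral.integral_of_le ht.1]
    simp [conv1, mul_add, hΨ]

lemma solution_unique (hσ : 0 < σ) (hK : Integrable (damp σ fun t => (K t : ℂ)))
    (hG : Integrable (damp σ fun t => (G t : ℂ)))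
    (hS : cconv (damp σ fun t => (K t : ℂ)) (damp σ fun t => (G t : ℂ))
      =ᵐ[volume] damp σ fun _ => 1)
    (hq : ‖lam‖ * ∫ t, ‖damp σ (fun t => (G t : ℂ)) t‖ < 1) {v₀ : ℂ} {T : ℝ} (hT : 0 < T)
    {v w v' w' : ℝ → ℂ} (hv' : IntervalIntegrable v' volume 0 T)
    (hv : ∀ t ∈ Icc (0:ℝ) T, v t = v₀ + ∫ s in (0:ℝ)..t, v' s)
    (hve : ∀ᵐ t ∂(volume.restrict (Ioo 0 T)),
      (∫ τ in (0:ℝ)..t, (K (t - τ) : ℂ) * v' τ) + lam * v t = 0)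
    (hw' : IntervalIntegrable w' volume 0 T)
    (hw : ∀ t ∈ Icc (0:ℝ) T, w t = v₀ + ∫ s in (0:ℝ)..t, w' s)
    (hwe : ∀ᵐ t ∂(volume.restrict (Ioo 0 T)),
      (∫ τ in (0:ℝ)..t, (K (t - τ) : ℂ) * w' τ) + lam * w t = 0) :
    ∀ t ∈ Icc (0:ℝ) T, v t = w t := by
  have hvi := (intervalIntegrable_iff_integrableOn_Ioc_of_le hT.le).1 hv'
  have hwi := (intervalIntegrable_iff_integrableOn_Ioc_of_le hT.le).1 hw'
  have hv1 := integrable_damp_indicator (σ := σ) hvi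
  have hw1 := (integrable_damp_indicator (σ := σ) hwi).const_mul (-1 : ℂ)
  rw [ae_restrict_iff' measurableSet_Ioo] at hve hwe
  have hone := integrable_damp_one hσ
  have hdiff : ∀ t, 0 < t → t < T → cconv (damp σ fun _ => 1)
      (damp σ ((Iio T).indicator v')) t + cconv (damp σ fun _ => 1)
      (fun x => -1 * damp σ ((Iio T).indicator w') x) t = (exp (-σ * t) : ℂ) * (v t - w t) := by
    intro t h0 ht
    rw [cconv_const_mul]
    dsimp only
    rw [cconv_damp_indicator _ _ h0 ht, cconv_damp_indicator _ _ h0 ht,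
      hv t ⟨h0.le, ht.le⟩, hw t ⟨h0.le, ht.le⟩]
    simp only [one_mul]
    ring
  have hres := cconv_eq_zero_of_resolvent (T := T) (lam := lam)
    (fun t ht => damp_of_nonpos σ (fun t => (G t : ℂ)) ht) hK hG (hv1.add hw1) hS hq (by
      filter_upwards [cconv_add_ae hK hv1 hw1, cconv_add_ae hone hv1 hw1, hve, hwe]
        with t h1 h2 h3 h4 ht
      rcases le_or_gt t 0 with h0 | h0
      · have hz : ∀ f g : ℝ → ℂ, cconv (damp σ f) (damp σ g) t = 0 := fun f g => by
          rw [damp_cconv, damp_of_nonpos _ _ h0]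
        rw [cconv_const_mul] at h1 h2
        simp only [hz, mul_zero, add_zero] at h1 h2
        refine (congrArg₂ (fun a b => a + lam * b) h1 h2).trans (by simp)
      · rw [hdiff t h0 ht] at h2
        rw [cconv_const_mul] at h1
        dsimp only at h1
        rw [cconv_damp_indicator _ _ h0 ht, cconv_damp_indicator _ _ h0 ht] at h1
        refine (congrArg₂ (fun a b => a + lam * b) h1 h2).trans ?_
        linear_combination (exp (-σ * t) : ℂ) * (h3 ⟨h0, ht⟩) -
          (exp (-σ * t) : ℂ) * (h4 ⟨h0, ht⟩))
  have hae : ∀ᵐ t, t ∈ Ioo 0 T → v t = w t := by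
    filter_upwards [hres, cconv_add_ae hone hv1 hw1] with t h1 h2 ht
    have h3 := h2.symm.trans (h1 ht.2)
    rw [hdiff t ht.1 ht.2] at h3
    have he : (exp (-σ * t) : ℂ) ≠ 0 := by exact_mod_cast (exp_pos _).ne'
    exact sub_eq_zero.1 ((mul_eq_zero.1 h3).resolve_left he)
  have hcont : ∀ {u u' : ℝ → ℂ}, IntegrableOn u' (Ioc 0 T) →
      (∀ t ∈ Icc (0:ℝ) T, u t = v₀ + ∫ s in (0:ℝ)..t, u' s) → ContinuousOn u (Icc 0 T) := by
    intro u u' hu hu'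
    refine ContinuousOn.congr (continuousOn_const.add ?_) hu'
    have := intervalIntegral.continuousOn_primitive_interval (f := u') (a := 0) (b := T)
      (μ := volume) (by rwa [uIcc_of_le hT.le, integrableOn_Icc_iff_integrableOn_Ioc])
    rwa [uIcc_of_le hT.le] at this
  refine Measure.eqOn_Icc_of_ae_eq volume hT.ne ?_ (hcont hvi hv) (hcont hwi hw)
  rw [Filter.EventuallyEq, ← restrict_Ioo_eq_restrict_Icc, ae_restrict_iff' measurableSet_Ioo]
  exact hae

end Volterra

section DistributedOrder

variable {μ : ℝ → ℝ}

/-- The measure with density `μ` on `(0, 1)`. -/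
noncomputable def orderMeasure (μ : ℝ → ℝ) : Measure ℝ :=
  (volume.restrict (Ioo 0 1)).withDensity fun α => ENNReal.ofReal (μ α)

lemma integral_orderMeasure (hmeas : Measurable μ) (hnn : ∀ α ∈ Icc (0:ℝ) 1, 0 ≤ μ α)
    (f : ℝ → ℝ) : ∫ α, f α ∂(orderMeasure μ) = ∫ α in Ioo (0:ℝ) 1, f α * μ α := by
  rw [orderMeasure, integral_withDensity_eq_integral_toReal_smul hmeas.ennreal_ofReal
    (ae_of_all _ fun _ => ENNReal.ofReal_lt_top)]
  refine setIntegral_congr_fun measurableSet_Ioo fun α hα => ?_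
  rw [ENNReal.toReal_ofReal (hnn α (Ioo_subset_Icc_self hα)), smul_eq_mul, mul_comm]

lemma isOrderMeasure_orderMeasure (hmeas : Measurable μ) (hnn : ∀ α ∈ Icc (0:ℝ) 1, 0 ≤ μ α)
    (hint : IntegrableOn μ (Ioo 0 1)) (hpos : 0 < ∫ α in Ioo (0:ℝ) 1, μ α) :
    IsOrderMeasure (orderMeasure μ) where
  finite := isFiniteMeasure_withDensity_ofReal hint.2
  ae_mem := (withDensity_absolutelyContinuous _ _).ae_le (ae_restrict_mem measurableSet_Ioo)
  ne_zero h := by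
    have := integral_orderMeasure hmeas hnn fun _ => 1
    simp only [h, integral_zero_measure, one_mul] at this
    exact hpos.ne this

lemma kker_eq_kerK (hmeas : Measurable μ) (hnn : ∀ α ∈ Icc (0:ℝ) 1, 0 ≤ μ α) (t : ℝ) :
    kker μ t = IsOrderMeasure.kerK (orderMeasure μ) t := by
  rw [kker, IsOrderMeasure.kerK, integral_orderMeasure hmeas hnn]
  congr 1
  ext α
  ring

lemma gker_eq_kerG (hmeas : Measurable μ) (hnn : ∀ α ∈ Icc (0:ℝ) 1, 0 ≤ μ α) (t : ℝ) :
    gker μ t = IsOrderMeasure.kerG (orderMeasure μ) t := by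
  simp only [gker, IsOrderMeasure.kerG, IsOrderMeasure.jump, integral_orderMeasure hmeas hnn]

end DistributedOrder

lemma IsOrderMeasure.integral_rpow_pos {ν : Measure ℝ} (hν : IsOrderMeasure ν) {s : ℝ}
    (hs : 0 < s) : 0 < ∫ α, s ^ α ∂ν := by
  have : NeZero ν := ⟨hν.ne_zero⟩
  simp only [Real.rpow_def_of_pos hs]
  exact integral_exp_pos (hν.integrable_exp_mul _)

/-- Proposition `zwyczajne`: for each `v₀, λ ∈ ℂ` the problem
`D^(μ) v + λ v = 0`, `v(0) = v₀` has a unique absolutely continuous solution,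
given by the Neumann series `v = v₀ ∑ (-λ)^k g^{[k]} * 1`, the series being
absolutely convergent in `W^{1,1}(0,T)` for each `T > 0`. -/
theorem ode_neumann_series (μ : ℝ → ℝ)
    (hmeas : Measurable μ)
    (hnn : ∀ α ∈ Icc (0:ℝ) 1, 0 ≤ μ α)
    (hint : IntegrableOn μ (Ioo 0 1))
    (hpos : 0 < ∫ α in Ioo (0:ℝ) 1, μ α)
    (v₀ lam : ℂ) (T : ℝ) (hT : 0 < T) :
    (∃ v : ℝ → ℂ, ∃ v' : ℝ → ℂ,
      IntervalIntegrable v' volume 0 T ∧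
      v 0 = v₀ ∧
      (∀ t ∈ Icc (0:ℝ) T, v t = v₀ + ∫ s in (0:ℝ)..t, v' s) ∧
      (∀ᵐ t ∂(volume.restrict (Ioo 0 T)),
        (∫ τ in (0:ℝ)..t, (kker μ (t - τ) : ℂ) * v' τ) + lam * v t = 0) ∧
      (∀ t ∈ Icc (0:ℝ) T,
        v t = v₀ * ∑' n : ℕ, (-lam) ^ n * (conv1 (gker μ) n t : ℂ))) ∧
    (∀ v w : ℝ → ℂ, ∀ v' w' : ℝ → ℂ,
      IntervalIntegrable v' volume 0 T →
      (∀ t ∈ Icc (0:ℝ) T, v t = v₀ + ∫ s in (0:ℝ)..t, v' s) →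
      (∀ᵐ t ∂(volume.restrict (Ioo 0 T)),
        (∫ τ in (0:ℝ)..t, (kker μ (t - τ) : ℂ) * v' τ) + lam * v t = 0) →
      IntervalIntegrable w' volume 0 T →
      (∀ t ∈ Icc (0:ℝ) T, w t = v₀ + ∫ s in (0:ℝ)..t, w' s) →
      (∀ᵐ t ∂(volume.restrict (Ioo 0 T)),
        (∫ τ in (0:ℝ)..t, (kker μ (t - τ) : ℂ) * w' τ) + lam * w t = 0) →
      ∀ t ∈ Icc (0:ℝ) T, v t = w t) ∧
    Summable (fun n : ℕ => ‖lam‖ ^ n *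
      ((∫ t in (0:ℝ)..T, |conv1 (gker μ) n t|) +
        ∫ t in (0:ℝ)..T, |convD (gker μ) n t|)) := by
  have hν := isOrderMeasure_orderMeasure hmeas hnn hint hpos
  have hk : kker μ = IsOrderMeasure.kerK (orderMeasure μ) := funext (kker_eq_kerK hmeas hnn)
  have hg : gker μ = IsOrderMeasure.kerG (orderMeasure μ) := funext (gker_eq_kerG hmeas hnn)
  rw [hk, hg]
  set ν := orderMeasure μ
  obtain ⟨σ, hq, hσ⟩ : ∃ σ : ℝ, ‖lam‖ * (∫ α, σ ^ α ∂ν)⁻¹ < 1 ∧ 0 < σ := by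
    have h := hν.tendsto_integral_rpow.const_mul ‖lam‖
    rw [mul_zero] at h
    exact ((h.eventually_lt_const one_pos).and (Filter.eventually_gt_atTop 0)).exists
  have hi : ∀ F : ℝ → ℝ, IntegrableOn (fun t => exp (-σ * t) * F t) (Ioi 0) →
      Integrable (damp σ fun t => (F t : ℂ)) := fun F h => by
    rw [integrable_damp_iff]
    exact_mod_cast h.ofReal (𝕜 := ℂ)
  have hK := hi _ (hν.laplace_kerK hσ).1
  have hG := hi _ (hν.laplace_kerG hσ).1
  have hq' : ‖lam‖ * ∫ t, ‖damp σ (fun t => (IsOrderMeasure.kerG ν t : ℂ)) t‖ < 1 := by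
    rw [integral_norm_damp]
    simp only [Complex.norm_real, Real.norm_of_nonneg (hν.kerG_nonneg _)]
    rwa [(hν.laplace_kerG hσ).2]
  have hS : cconv (damp σ fun t => (IsOrderMeasure.kerK ν t : ℂ))
      (damp σ fun t => (IsOrderMeasure.kerG ν t : ℂ)) =ᵐ[volume] damp σ fun _ => 1 := by
    rw [damp_cconv]
    filter_upwards [sonine_of_laplace (fun t ht => hν.kerK_nonneg ht)
      (fun t _ => hν.kerG_nonneg t) (fun s hs => hν.integral_rpow_pos hs)
      (fun s hs => hν.laplace_kerK hs) (fun s hs => hν.laplace_kerG hs)] with t ht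
    rcases le_or_gt t 0 with h | h
    · rw [damp_of_nonpos _ _ h, damp_of_nonpos _ _ h]
    · rw [damp_of_pos _ _ h, damp_of_pos _ _ h, ht h]
  exact ⟨exists_solution hσ hK hG hS hq' v₀ hT, fun v w v' w' hv' hv hve hw' hw hwe =>
    solution_unique hσ hK hG hS hq' hT hv' hv hve hw' hw hwe,
    summable_neumann_series hσ hG hq' hT⟩
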